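/- For every Δ ∈ ℕ and every α > 0 there exists n₀ ∈ ℕ such that the following holds for all n ≥ n₀: if G is an n-vertex graph with minimum degree δ(G) ≥ (1+α)·n/2, then G contains a copy of every n-vertex tree with maximum degree at most Δ. -/

import Mathlib

section BoundedDegreeTrees

open Finset
open scoped Classical

set_option linter.unusedSectionVars false

universe u

/-- A rooting of a graph: every non-root vertex `v` has a parent `par v`, of smaller rank, and
these parent edges are all the edges. -/
structure Rooting {U : Type*} (T : SimpleGraph U) where
  root : U
  par : U → U
  rk : U → ℕ
  par_root : par root = root
  adj_par : ∀ v, v ≠ root → T.Adj v (par v)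
  rk_par : ∀ v, v ≠ root → rk (par v) < rk v
  par_of_adj : ∀ a b, T.Adj a b → (a ≠ root ∧ par a = b) ∨ (b ≠ root ∧ par b = a)

theorem SimpleGraph.IsTree.exists_rooting {U : Type*} {T : SimpleGraph U} (hT : T.IsTree) (r : U) :
    ∃ R : Rooting T, R.root = r := by
  choose f hf hf' using (hT.existsUnique_path · r)
  have key : ∀ a b, T.Adj a b → (f a).length ≤ (f b).length → ∃ h : T.Adj b a,
      f b = SimpleGraph.Walk.cons h (f a) := by
    intro a b h h'
    refine ⟨h.symm, (hf' _ _ ((SimpleGraph.Walk.cons_isPath_iff _ _).2 ⟨hf _, fun hy => ?_⟩)).symm⟩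
    have h1 := hf' _ _ ((hf a).dropUntil hy)
    have h2 := congrArg SimpleGraph.Walk.length ((f a).take_spec hy)
    rw [SimpleGraph.Walk.length_append, h1] at h2
    exact h.ne (SimpleGraph.Walk.eq_of_length_eq_zero (p := (f a).takeUntil b hy) (by omega))
  have key2 : ∀ a b, T.Adj a b → (f a).length ≤ (f b).length → b ≠ r ∧ (f b).snd = a := by
    intro a b h h'
    obtain ⟨h1, h2⟩ := key a b h h'
    refine ⟨?_, by rw [h2]; simp⟩
    rintro rfl
    have h3 := hf' _ _ (SimpleGraph.Walk.IsPath.nil (u := b))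
    rw [← h3] at h2
    cases h2
  have nn : ∀ v, v ≠ r → ¬ (f v).Nil := fun v hv => SimpleGraph.Walk.not_nil_of_ne hv
  refine ⟨⟨r, fun v => (f v).snd, fun v => (f v).length, ?_, ?_, ?_, ?_⟩, rfl⟩
  · rw [← hf' _ _ (SimpleGraph.Walk.IsPath.nil (u := r))]; rfl
  · intro v hv
    exact SimpleGraph.Walk.adj_snd (nn v hv)
  · intro v hv
    have := hf' _ _ (hf v).tail
    rw [← this, ← SimpleGraph.Walk.length_tail_add_one (nn v hv)]
    exact Nat.lt_succ_self _
  · intro a b h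
    rcases le_total (f a).length (f b).length with h' | h'
    · exact Or.inr (key2 a b h h')
    · exact Or.inl (key2 b a h.symm h')

namespace Rooting

variable {U : Type*} [Fintype U] {T : SimpleGraph U} (R : Rooting T)

/-- A vertex set containing the root and closed under taking parents. -/
def Closed (S : Finset U) : Prop := R.root ∈ S ∧ ∀ v ∈ S, R.par v ∈ S

/-- The descendants of `v`, including `v`. -/
noncomputable def desc (v : U) : Finset U := {w | ∃ k, R.par^[k] w = v}

variable {R}

theorem self_mem_desc (v : U) : v ∈ R.desc v := by
  simp only [desc, mem_filter, mem_univ, true_and]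
  exact ⟨0, rfl⟩

theorem mem_desc_of_par_mem {v w : U} (h : R.par w ∈ R.desc v) : w ∈ R.desc v := by
  simp only [desc, mem_filter, mem_univ, true_and] at *
  obtain ⟨k, hk⟩ := h
  exact ⟨k + 1, by simpa using hk⟩

theorem par_mem_desc {v w : U} (h : w ∈ R.desc v) (hw : w ≠ v) : R.par w ∈ R.desc v := by
  simp only [desc, mem_filter, mem_univ, true_and] at *
  obtain ⟨_ | k, hk⟩ := h
  · exact absurd hk hw
  · exact ⟨k, by simpa using hk⟩

theorem mem_desc_root (w : U) : w ∈ R.desc R.root := by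
  induction h : R.rk w using Nat.strong_induction_on generalizing w with
  | _ n ih =>
    by_cases hw : w = R.root
    · rw [hw]; exact self_mem_desc _
    · exact mem_desc_of_par_mem (ih _ (h ▸ R.rk_par w hw) _ rfl)

theorem rk_le_of_mem_desc {v w : U} (h : w ∈ R.desc v) : R.rk v ≤ R.rk w := by
  induction hn : R.rk w using Nat.strong_induction_on generalizing w with
  | _ n ih =>
    by_cases hw : w = v
    · rw [← hn, hw]
    · by_cases hr : w = R.root
      · have : R.par w ∈ R.desc v := par_mem_desc h hw
        simp only [desc, mem_filter, mem_univ, true_and] at h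
        obtain ⟨k, hk⟩ := h
        rw [hr, Function.iterate_fixed R.par_root] at hk
        exact absurd (hr.trans hk) hw
      · have h1 := R.rk_par w hr
        exact (ih _ (hn ▸ h1) (par_mem_desc h hw) rfl).trans (hn ▸ h1.le)

/-- A proper descendant of `v` descends from a child of `v`. -/
theorem exists_child_of_mem_desc {v w : U} (h : w ∈ R.desc v) (hw : w ≠ v) :
    ∃ c, c ≠ R.root ∧ R.par c = v ∧ w ∈ R.desc c := by
  induction hn : R.rk w using Nat.strong_induction_on generalizing w with
  | _ n ih =>
    have hr : w ≠ R.root := by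
      rintro rfl
      simp only [desc, mem_filter, mem_univ, true_and] at h
      obtain ⟨k, hk⟩ := h
      rw [Function.iterate_fixed R.par_root] at hk
      exact hw hk
    have h1 := par_mem_desc h hw
    by_cases h2 : R.par w = v
    · exact ⟨w, hr, h2, self_mem_desc _⟩
    · obtain ⟨c, hc, hcv, hcw⟩ := ih _ (hn ▸ R.rk_par w hr) h1 h2 rfl
      exact ⟨c, hc, hcv, mem_desc_of_par_mem hcw⟩

theorem Closed.sdiff_desc {S : Finset U} (hS : R.Closed S) {v : U} (hv : v ≠ R.root) :
    R.Closed (S \ R.desc v) := by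
  refine ⟨?_, ?_⟩
  · rw [mem_sdiff]
    refine ⟨hS.1, fun h => ?_⟩
    simp only [desc, mem_filter, mem_univ, true_and] at h
    obtain ⟨k, hk⟩ := h
    rw [Function.iterate_fixed R.par_root] at hk
    exact hv hk.symm
  · intro w hw
    rw [mem_sdiff] at hw ⊢
    exact ⟨hS.2 _ hw.1, fun h => hw.2 (mem_desc_of_par_mem h)⟩

theorem Closed.insert_attached {S : Finset U} (hS : R.Closed S) {t : U} (ht : R.par t ∈ S) :
    R.Closed (insert t S) := by
  refine ⟨mem_insert_of_mem hS.1, fun w hw => ?_⟩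
  rcases mem_insert.1 hw with rfl | hw
  · exact mem_insert_of_mem ht
  · exact mem_insert_of_mem (hS.2 _ hw)

/-- A larger closed set contains a vertex attached to the smaller one. -/
theorem Closed.exists_attached {S C : Finset U} (hS : R.Closed S) (hC : R.Closed C)
    (h : ¬ C ⊆ S) : ∃ t ∈ C, t ∉ S ∧ R.par t ∈ S := by
  have hne : (C \ S).Nonempty := by rwa [sdiff_nonempty]
  obtain ⟨t, ht, hmin⟩ := exists_min_image _ R.rk hne
  rw [mem_sdiff] at ht
  refine ⟨t, ht.1, ht.2, ?_⟩
  by_contra hp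
  have hr : t ≠ R.root := fun h => ht.2 (h ▸ hS.1)
  exact absurd (hmin (R.par t) (mem_sdiff.2 ⟨hC.2 _ ht.1, hp⟩)) (not_le.2 (R.rk_par t hr))

/-- Outside a closed set, the only neighbour inside it can be the parent. -/
theorem Closed.eq_par_of_adj {S : Finset U} (hS : R.Closed S) {a t : U} (ha : a ∈ S) (ht : t ∉ S)
    (h : T.Adj a t) : a = R.par t := by
  rcases R.par_of_adj a t h with ⟨_, h⟩ | ⟨_, h⟩
  · exact absurd (h ▸ hS.2 a ha) ht
  · exact h.symm

theorem closed_univ : R.Closed univ := ⟨mem_univ _, fun _ _ => mem_univ _⟩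

/-- Closed sets of every intermediate size exist. -/
theorem Closed.exists_between {S C : Finset U} (hS : R.Closed S) (hC : R.Closed C) (h : S ⊆ C)
    {k : ℕ} (h1 : #S ≤ k) (h2 : k ≤ #C) : ∃ D, R.Closed D ∧ S ⊆ D ∧ D ⊆ C ∧ #D = k := by
  induction k, h1 using Nat.le_induction with
  | base => exact ⟨S, hS, Subset.rfl, h, rfl⟩
  | succ k hk ih =>
    obtain ⟨D, hD, hSD, hDC, hc⟩ := ih (by omega)
    obtain ⟨t, htC, htD, hp⟩ := hD.exists_attached hC (fun h => by
      have := card_le_card h; omega)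
    exact ⟨insert t D, hD.insert_attached hp, hSD.trans (subset_insert _ _),
      insert_subset htC hDC, by rw [card_insert_of_notMem htD, hc]⟩

theorem card_children_le {Δ : ℕ} (hΔ : ∀ v, #{w | T.Adj v w} ≤ Δ) (v : U) :
    #{c | c ≠ R.root ∧ R.par c = v} ≤ Δ := by
  refine (card_le_card fun c hc => ?_).trans (hΔ v)
  simp only [mem_filter, mem_univ, true_and] at *
  exact hc.2 ▸ (R.adj_par c hc.1).symm

theorem card_le_of_par_mem {Δ : ℕ} (hΔ : ∀ v, #{w | T.Adj v w} ≤ Δ) {S C : Finset U}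
    (h : ∀ v ∈ C, R.par v ∈ S) : #C ≤ (Δ + 1) * #S := by
  refine card_le_mul_card_image_of_maps_to h _ fun b _ => ?_
  calc #{a ∈ C | R.par a = b} ≤ #(insert R.root ({c | c ≠ R.root ∧ R.par c = b} : Finset U)) := by
        refine card_le_card fun c hc => ?_
        simp only [mem_filter, mem_univ, true_and, mem_insert] at *
        tauto
    _ ≤ _ := (card_insert_le _ _).trans (by have := card_children_le (R := R) hΔ b; omega)

/-- In a closed set `C`, among the vertices having at least `s` descendants in `C`, one of
maximal rank has at most `Δ * s + 1` of them. -/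
theorem exists_desc_card {Δ : ℕ} (hΔ : ∀ v, #{w | T.Adj v w} ≤ Δ) (C D : Finset U) {s : ℕ} {v₀ : U}
    (hC : R.Closed C) (hD : ∀ c, c ∈ C → R.par c ∈ D → c ∈ D) (hv₀ : v₀ ∈ D) (hs : 0 < s)
    (h : s ≤ #(C ∩ R.desc v₀)) :
    ∃ v ∈ D, s ≤ #(C ∩ R.desc v) ∧ #(C ∩ R.desc v) ≤ Δ * s + 1 := by
  obtain ⟨v, hv, hmax⟩ := exists_max_image (D.filter fun v => s ≤ #(C ∩ R.desc v)) R.rk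
    ⟨v₀, by simp [hv₀, h]⟩
  rw [mem_filter] at hv
  refine ⟨v, hv.1, hv.2, ?_⟩
  have hsub : C ∩ R.desc v ⊆ insert v
      (({c | c ≠ R.root ∧ R.par c = v} : Finset U).biUnion fun c => C ∩ R.desc c) := by
    intro w hw
    rw [mem_inter] at hw
    by_cases hwv : w = v
    · simp [hwv]
    · obtain ⟨c, h1, h2, h3⟩ := exists_child_of_mem_desc hw.2 hwv
      refine mem_insert_of_mem (mem_biUnion.2 ⟨c, by simp [h1, h2], mem_inter.2 ⟨hw.1, h3⟩⟩)
  refine (card_le_card hsub).trans ((card_insert_le _ _).trans ?_)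
  gcongr
  refine (card_biUnion_le_card_mul _ _ s fun c hc => ?_).trans ?_
  · simp only [mem_filter, mem_univ, true_and] at hc
    by_contra hcs
    push Not at hcs
    have hcC : c ∈ C := by
      obtain ⟨w, hw⟩ := card_pos.1 (hs.trans hcs)
      rw [mem_inter] at hw
      obtain ⟨hwC, hw⟩ := hw
      simp only [desc, mem_filter, mem_univ, true_and] at hw
      obtain ⟨k, rfl⟩ := hw
      clear * - hwC hC
      induction k with
      | zero => exact hwC
      | succ k ih => rw [Function.iterate_succ_apply']; exact hC.2 _ ih
    have := hmax c (mem_filter.2 ⟨hD c hcC (by rw [hc.2]; exact hv.1), hcs.le⟩)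
    have h2 := R.rk_par c hc.1
    rw [hc.2] at h2
    omega
  · gcongr
    exact card_children_le hΔ v

end Rooting

/-- A small connected set `C` attached to the rest of the tree by a single edge, in the tree
rooted inside `C`. -/
theorem SimpleGraph.IsTree.exists_pendant {U : Type*} [Fintype U] {T : SimpleGraph U}
    (hT : T.IsTree) {Δ : ℕ} (hΔ : ∀ v, #{w | T.Adj v w} ≤ Δ) {s : ℕ} (hs : 0 < s)
    (hsU : s ≤ Fintype.card U) :
    ∃ (R : Rooting T) (C : Finset U), R.Closed C ∧ s ≤ #C ∧ #C ≤ Δ * s + 1 ∧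
      (∀ w ∈ C, w ≠ R.root → ∀ b, T.Adj w b → b ∈ C) ∧
      ∃ v', ∀ b, b ∉ C → R.par b ∈ C → b = v' := by
  have hne : Nonempty U := Fintype.card_pos_iff.1 (by omega)
  obtain ⟨R₀, hR₀⟩ := hT.exists_rooting (Classical.arbitrary U)
  obtain ⟨v, -, h1, h2⟩ := Rooting.exists_desc_card (R := R₀) hΔ univ univ
    (v₀ := R₀.root) (s := s) Rooting.closed_univ (fun _ _ _ => mem_univ _) (mem_univ _) hs (by
      rw [univ_inter, eq_univ_of_forall Rooting.mem_desc_root]; simpa using hsU)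
  rw [univ_inter] at h1 h2
  obtain ⟨R, hR⟩ := hT.exists_rooting v
  have hnb : ∀ w ∈ R₀.desc v, w ≠ v → ∀ b, T.Adj w b → b ∈ R₀.desc v := by
    intro w hw hwv b hb
    rcases R₀.par_of_adj w b hb with ⟨_, h⟩ | ⟨_, h⟩
    · exact h ▸ Rooting.par_mem_desc hw hwv
    · exact Rooting.mem_desc_of_par_mem (h ▸ hw)
  refine ⟨R, R₀.desc v, ⟨by rw [hR]; exact Rooting.self_mem_desc v, fun w hw => ?_⟩, h1, h2, hR ▸ hnb,
    R₀.par v, fun b hb hpb => ?_⟩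
  · by_cases hwv : w = v
    · rw [hwv, ← hR, R.par_root, hR]; exact Rooting.self_mem_desc v
    · exact hnb w hw hwv _ (R.adj_par w (hR ▸ hwv))
  · have hbr : b ≠ R.root := by
      rintro rfl; exact hb (by rw [hR]; exact Rooting.self_mem_desc v)
    have hadj := R.adj_par b hbr
    have hpv : R.par b = v := by
      by_contra hne'
      exact hb (hnb _ hpb hne' b hadj.symm)
    rw [hpv] at hadj
    rcases R₀.par_of_adj v b hadj.symm with ⟨_, h⟩ | ⟨_, h⟩
    · exact h.symm
    · exact absurd (Rooting.mem_desc_of_par_mem (by rw [h]; exact Rooting.self_mem_desc v)) hb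

section Embedding

variable {U V : Type*} [Fintype U] [Fintype V] {T : SimpleGraph U} {G : SimpleGraph V}

/-- The tree vertex `q` can be moved to `x`, and its place `f q` is a common neighbour
of `u` and `u'`. -/
def IsAbsorber (G : SimpleGraph V) (T : SimpleGraph U) (f : U → V) (e : V × V × V) (q : U) : Prop :=
  G.Adj e.1 (f q) ∧ G.Adj e.2.1 (f q) ∧ ∀ p, T.Adj q p → G.Adj e.2.2 (f p)

/-- An embedding `f` of the part `S` of the tree `T`, with a set `Q` of vertices whose
neighbourhoods are already embedded and which contains `L` absorbers for every triple. -/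
structure AbsorbingEmbedding (G : SimpleGraph V) (T : SimpleGraph U) (S : Finset U) (f : U → V)
    (Q : Finset U) (L : ℕ) : Prop where
  inj : ∀ a ∈ S, ∀ b ∈ S, f a = f b → a = b
  hom : ∀ a ∈ S, ∀ b ∈ S, T.Adj a b → G.Adj (f a) (f b)
  mem : ∀ q ∈ Q, q ∈ S
  nbr : ∀ q ∈ Q, ∀ p, T.Adj q p → p ∈ S ∧ p ∉ Q
  le_card : ∀ e, L ≤ #{q ∈ Q | IsAbsorber G T f e q}

theorem isAbsorber_congr {f f' : U → V} {e : V × V × V} {q : U} (hq : f q = f' q)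
    (h : ∀ p, T.Adj q p → f p = f' p) : IsAbsorber G T f e q ↔ IsAbsorber G T f' e q := by
  unfold IsAbsorber
  rw [hq]
  constructor
  · rintro ⟨h1, h2, h3⟩
    exact ⟨h1, h2, fun p hp => h p hp ▸ h3 p hp⟩
  · rintro ⟨h1, h2, h3⟩
    exact ⟨h1, h2, fun p hp => (h p hp).symm ▸ h3 p hp⟩

namespace AbsorbingEmbedding

variable {S : Finset U} {f : U → V} {Q : Finset U} {L : ℕ} {R : Rooting T}

theorem mono (h : AbsorbingEmbedding G T S f Q L) {L' : ℕ} (hL : L' ≤ L) :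
    AbsorbingEmbedding G T S f Q L' :=
  ⟨h.inj, h.hom, h.mem, h.nbr, fun e => hL.trans (h.le_card e)⟩

theorem card_image (h : AbsorbingEmbedding G T S f Q L) : #(S.image f) = #S :=
  card_image_of_injOn fun a ha b hb => h.inj a ha b hb

/-- Adding a leaf `t` at an unused neighbour `y` of the place of its parent. -/
theorem extend (h : AbsorbingEmbedding G T S f Q L) (hS : R.Closed S) {t : U} (ht : t ∉ S)
    (hp : R.par t ∈ S) {y : V} (hy : y ∉ S.image f) (hadj : G.Adj (f (R.par t)) y) :
    AbsorbingEmbedding G T (insert t S) (Function.update f t y) Q L := by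
  have hne : ∀ a ∈ S, Function.update f t y a = f a := fun a ha =>
    Function.update_of_ne (ne_of_mem_of_not_mem ha ht) _ _
  have hy' : ∀ a ∈ S, f a ≠ y := fun a ha h => hy (mem_image.2 ⟨a, ha, h⟩)
  refine ⟨?_, ?_, fun q hq => mem_insert_of_mem (h.mem q hq), fun q hq p hqp =>
    ⟨mem_insert_of_mem (h.nbr q hq p hqp).1, (h.nbr q hq p hqp).2⟩, fun e => ?_⟩
  · intro a ha b hb hab
    rw [mem_insert] at ha hb
    rcases ha with rfl | ha <;> rcases hb with rfl | hb
    · rfl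
    · rw [Function.update_self, hne b hb] at hab
      exact absurd hab.symm (hy' b hb)
    · rw [Function.update_self, hne a ha] at hab
      exact absurd hab (hy' a ha)
    · rw [hne a ha, hne b hb] at hab
      exact h.inj a ha b hb hab
  · intro a ha b hb hab
    rw [mem_insert] at ha hb
    rcases ha with rfl | ha <;> rcases hb with rfl | hb
    · exact absurd hab (T.loopless.irrefl _)
    · rw [Function.update_self, hne b hb, hS.eq_par_of_adj hb ht hab.symm]
      exact hadj.symm
    · rw [Function.update_self, hne a ha, hS.eq_par_of_adj ha ht hab]
      exact hadj
    · rw [hne a ha, hne b hb]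
      exact h.hom a ha b hb hab
  · refine (h.le_card e).trans (card_le_card fun q hq => ?_)
    rw [mem_filter] at hq ⊢
    exact ⟨hq.1, (isAbsorber_congr (hne q (h.mem q hq.1))
      fun p hp => hne p (h.nbr q hq.1 p hp).1).2 hq.2⟩

/-- Adding a leaf `t` at the place of an absorber, which moves to an unused vertex `x`. The new
place can be chosen to have many neighbours in a given set `Y`. -/
theorem absorb (h : AbsorbingEmbedding G T S f Q (L + 1)) (hS : R.Closed S) {t : U} (ht : t ∉ S)
    (hp : R.par t ∈ S) {x : V} (hx : x ∉ S.image f) {Y : Finset V} (hY : Y.Nonempty) :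
    ∃ f' Q', AbsorbingEmbedding G T (insert t S) f' Q' L ∧
      (insert t S).image f' = insert x (S.image f) ∧
      (L + 1) * #Y ≤ Fintype.card U * #{y ∈ Y | G.Adj (f' t) y} := by
  obtain ⟨q, hqQ, hq, hqY⟩ : ∃ q ∈ Q, (∃ y ∈ Y, IsAbsorber G T f (f (R.par t), y, x) q) ∧
      (L + 1) * #Y ≤ Fintype.card U * #{y ∈ Y | IsAbsorber G T f (f (R.par t), y, x) q} := by
    have hcount : (L + 1) * #Y ≤ ∑ q ∈ Q, #{y ∈ Y | IsAbsorber G T f (f (R.par t), y, x) q} := by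
      have := sum_card_bipartiteAbove_eq_sum_card_bipartiteBelow (s := Y) (t := Q)
        (fun y q => IsAbsorber G T f (f (R.par t), y, x) q)
      unfold bipartiteAbove bipartiteBelow at this
      rw [← this, mul_comm, ← smul_eq_mul]
      exact card_nsmul_le_sum _ _ _ fun y _ => h.le_card _
    have hYpos := hY.card_pos
    have hQne : Q.Nonempty := by
      by_contra hQ
      rw [not_nonempty_iff_eq_empty] at hQ
      rw [hQ, sum_empty] at hcount
      have : 0 < (L + 1) * #Y := by positivity
      omega
    obtain ⟨q, hq, hmax⟩ := exists_max_image Q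
      (fun q => #{y ∈ Y | IsAbsorber G T f (f (R.par t), y, x) q}) hQne
    have h2 : (L + 1) * #Y ≤ Fintype.card U * #{y ∈ Y | IsAbsorber G T f (f (R.par t), y, x) q} := by
      refine hcount.trans ((sum_le_card_nsmul Q _ _ hmax).trans ?_)
      rw [smul_eq_mul]
      exact Nat.mul_le_mul_right _ (card_le_univ _)
    refine ⟨q, hq, ?_, h2⟩
    have h3 : 0 < #{y ∈ Y | IsAbsorber G T f (f (R.par t), y, x) q} := by
      have : 0 < (L + 1) * #Y := by positivity
      exact Nat.pos_of_mul_pos_left (this.trans_le h2)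
    obtain ⟨y, hy⟩ := card_pos.1 h3
    rw [mem_filter] at hy
    exact ⟨y, hy⟩
  obtain ⟨y₀, -, hab1, -, hab3⟩ := hq
  simp only at hab1 hab3
  have hqS := h.mem q hqQ
  have hqt : q ≠ t := fun h' => ht (h' ▸ hqS)
  set f' := Function.update (Function.update f q x) t (f q) with hf'
  have hft : f' t = f q := Function.update_self ..
  have hfq : f' q = x := by rw [hf', Function.update_of_ne hqt, Function.update_self]
  have hfa : ∀ a ∈ S, a ≠ q → f' a = f a := fun a ha haq => by
    rw [hf', Function.update_of_ne (ne_of_mem_of_not_mem ha ht), Function.update_of_ne haq]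
  have hx' : ∀ a ∈ S, f a ≠ x := fun a ha h => hx (mem_image.2 ⟨a, ha, h⟩)
  have hnt : ¬ T.Adj q t := fun h' => ht (h.nbr q hqQ t h').1
  refine ⟨f', Q.erase q, ⟨?_, ?_, ?_, ?_, ?_⟩, ?_, ?_⟩
  · intro a ha b hb hab
    rw [mem_insert] at ha hb
    rcases ha with rfl | ha <;> rcases hb with rfl | hb
    · rfl
    · by_cases hbq : b = q
      · rw [hft, hbq, hfq] at hab; exact absurd hab (hx' q hqS)
      · rw [hft, hfa b hb hbq] at hab; exact absurd (h.inj _ hqS _ hb hab).symm hbq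
    · by_cases haq : a = q
      · rw [hft, haq, hfq] at hab; exact absurd hab.symm (hx' q hqS)
      · rw [hft, hfa a ha haq] at hab; exact absurd (h.inj _ ha _ hqS hab) haq
    · by_cases haq : a = q <;> by_cases hbq : b = q
      · rw [haq, hbq]
      · rw [haq, hfq, hfa b hb hbq] at hab; exact absurd hab.symm (hx' b hb)
      · rw [hbq, hfq, hfa a ha haq] at hab; exact absurd hab (hx' a ha)
      · rw [hfa a ha haq, hfa b hb hbq] at hab; exact h.inj _ ha _ hb hab
  · have hsw : ∀ a ∈ S, T.Adj a t → G.Adj (f' a) (f' t) := by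
      intro a ha hat
      have haq : a ≠ q := by rintro rfl; exact hnt hat
      rw [hft, hfa a ha haq, hS.eq_par_of_adj ha ht hat]
      exact hab1
    have hsw2 : ∀ a ∈ S, T.Adj q a → G.Adj (f' q) (f' a) := by
      intro a ha hqa
      rw [hfq, hfa a ha hqa.ne']
      exact hab3 a hqa
    intro a ha b hb hab
    rw [mem_insert] at ha hb
    rcases ha with rfl | ha <;> rcases hb with rfl | hb
    · exact absurd hab (T.loopless.irrefl _)
    · exact (hsw b hb hab.symm).symm
    · exact hsw a ha hab
    · by_cases haq : a = q
      · subst haq; exact hsw2 b hb hab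
      · by_cases hbq : b = q
        · subst hbq; exact (hsw2 a ha hab.symm).symm
        · rw [hfa a ha haq, hfa b hb hbq]; exact h.hom a ha b hb hab
  · exact fun q' hq' => mem_insert_of_mem (h.mem q' (mem_of_mem_erase hq'))
  · exact fun q' hq' p hp => ⟨mem_insert_of_mem (h.nbr q' (mem_of_mem_erase hq') p hp).1,
      fun h' => (h.nbr q' (mem_of_mem_erase hq') p hp).2 (mem_of_mem_erase h')⟩
  · intro e
    have hsub : ({q ∈ Q | IsAbsorber G T f e q}).erase q ⊆ {q' ∈ Q.erase q | IsAbsorber G T f' e q'} := by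
      intro q' hq'
      rw [mem_erase, mem_filter] at hq'
      rw [mem_filter, mem_erase]
      refine ⟨⟨hq'.1, hq'.2.1⟩, (isAbsorber_congr (hfa q' (h.mem _ hq'.2.1) hq'.1)
        fun p hp => ?_).2 hq'.2.2⟩
      have := h.nbr q' hq'.2.1 p hp
      exact hfa p this.1 (fun h' => this.2 (h' ▸ hqQ))
    have h1 := card_le_card hsub
    have h2 := pred_card_le_card_erase (s := {q ∈ Q | IsAbsorber G T f e q}) (a := q)
    have h3 := h.le_card e
    omega
  · ext z
    simp only [mem_image, mem_insert]
    constructor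
    · rintro ⟨a, rfl | ha, rfl⟩
      · exact Or.inr ⟨q, hqS, hft.symm⟩
      · by_cases haq : a = q
        · left; rw [haq, hfq]
        · right; exact ⟨a, ha, (hfa a ha haq).symm⟩
    · rintro (rfl | ⟨a, ha, rfl⟩)
      · exact ⟨q, Or.inr hqS, hfq⟩
      · by_cases haq : a = q
        · exact ⟨t, Or.inl rfl, by rw [hft, haq]⟩
        · exact ⟨a, Or.inr ha, hfa a ha haq⟩
  · rw [hft]
    refine hqY.trans (Nat.mul_le_mul_left _ (card_le_card fun y hy => ?_))
    rw [mem_filter] at hy ⊢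
    exact ⟨hy.1, hy.2.2.1.symm⟩

/-- If few vertices remain, the embedding can be completed. -/
theorem complete (hUV : Fintype.card U = Fintype.card V) {L : ℕ}
    (h : AbsorbingEmbedding G T S f Q L) (hS : R.Closed S) (hL : Fintype.card U ≤ #S + L) :
    ∃ f' : U → V, Function.Injective f' ∧ ∀ a b, T.Adj a b → G.Adj (f' a) (f' b) := by
  induction hk : Fintype.card U - #S generalizing S f Q L with
  | zero =>
    have hu : S = univ := (card_eq_iff_eq_univ S).1 (le_antisymm (card_le_univ S) (by omega))
    subst hu
    exact ⟨f, fun a b => h.inj a (mem_univ _) b (mem_univ _),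
      fun a b => h.hom a (mem_univ _) b (mem_univ _)⟩
  | succ k ih =>
    obtain ⟨t, -, ht, hp⟩ := hS.exists_attached Rooting.closed_univ (fun h => by
      have := card_le_card h; rw [card_univ] at this; omega)
    obtain ⟨x, hx⟩ : ∃ x, x ∉ S.image f := by
      by_contra! hcon
      have h1 := card_le_card (fun x _ => hcon x : univ ⊆ S.image f)
      rw [card_univ, h.card_image] at h1
      omega
    obtain ⟨L, rfl⟩ : ∃ L', L = L' + 1 := ⟨L - 1, by omega⟩
    obtain ⟨f', Q', h', -, -⟩ := h.absorb hS ht hp hx (singleton_nonempty x)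
    have hc := card_insert_of_notMem ht
    exact ih h' (hS.insert_attached hp) (by omega) (by omega)

/-- Greedy extension to a larger closed set. -/
theorem extend_greedy {d : ℕ} (hd : ∀ u, d ≤ #{w | G.Adj u w}) {C : Finset U} (hC : R.Closed C)
    (hCd : #C ≤ d) (h : AbsorbingEmbedding G T S f Q L) (hS : R.Closed S) (hSC : S ⊆ C) :
    ∃ f', AbsorbingEmbedding G T C f' Q L := by
  induction hk : #C - #S generalizing S f with
  | zero =>
    rw [eq_of_subset_of_card_le hSC (by omega)] at h
    exact ⟨f, h⟩
  | succ k ih =>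
    obtain ⟨t, htC, ht, hp⟩ := hS.exists_attached hC (fun h => by
      have := card_le_card h; omega)
    obtain ⟨y, hy⟩ : (({w | G.Adj (f (R.par t)) w} : Finset V) \ S.image f).Nonempty := by
      rw [← card_pos]
      have h1 := le_card_sdiff (S.image f) ({w | G.Adj (f (R.par t)) w} : Finset V)
      have h2 := hd (f (R.par t))
      rw [h.card_image] at h1
      omega
    simp only [mem_sdiff, mem_filter, mem_univ, true_and] at hy
    have hc := card_insert_of_notMem ht
    exact ih (h.extend hS ht hp hy.2 hy.1) (hS.insert_attached hp) (insert_subset htC hSC)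
      (by omega)

end AbsorbingEmbedding

end Embedding

/-- A vertex chosen by averaging lies in sets `N e` of a large proportion of the total weight. -/
theorem exists_mem_weight_le {Ω V : Type*} [Fintype V] (s : Finset Ω) (w : Ω → ℝ)
    (hw : ∀ e, 0 ≤ w e) (N : Ω → Finset V) {A : Finset V} (hA : A.Nonempty)
    (hN : ∀ e ∈ s, N e ⊆ A) {γ : ℝ} (hγ : 0 ≤ γ)
    (h : ∀ e ∈ s, γ * Fintype.card V ≤ #(N e)) :
    ∃ y ∈ A, γ * ∑ e ∈ s, w e ≤ ∑ e ∈ s with y ∈ N e, w e := by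
  have hW : 0 ≤ γ * ∑ e ∈ s, w e := mul_nonneg hγ (sum_nonneg fun e _ => hw e)
  refine exists_le_of_sum_le hA ?_
  calc ∑ y ∈ A, γ * ∑ e ∈ s, w e = #A * (γ * ∑ e ∈ s, w e) := by simp
    _ ≤ Fintype.card V * (γ * ∑ e ∈ s, w e) := by
        gcongr; exact card_le_univ _
    _ = ∑ e ∈ s, (γ * Fintype.card V) * w e := by rw [← mul_sum]; ring
    _ ≤ ∑ e ∈ s, #(N e) * w e := by
        refine sum_le_sum fun e he => mul_le_mul_of_nonneg_right (h e he) (hw e)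
    _ = ∑ e ∈ s, ∑ y ∈ A, if y ∈ N e then w e else 0 := by
        refine sum_congr rfl fun e he => ?_
        rw [← sum_filter, sum_const, nsmul_eq_mul, filter_mem_eq_inter,
          inter_eq_right.2 (hN e he)]
    _ = ∑ y ∈ A, ∑ e ∈ s with y ∈ N e, w e := by
        rw [sum_comm]
        refine sum_congr rfl fun y _ => ?_
        rw [sum_filter]

theorem Finset.image_insert_update {U V : Type*} {S : Finset U} {t : U} (ht : t ∉ S)
    (f : U → V) (y : V) : (insert t S).image (Function.update f t y) = insert y (S.image f) := by
  rw [image_insert, Function.update_self]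
  congr 1
  exact image_congr fun a ha => Function.update_of_ne (ne_of_mem_of_not_mem ha ht) _ _

section Embedding

variable {U V : Type*} [Fintype U] [Fintype V] {T : SimpleGraph U} {G : SimpleGraph V}

namespace AbsorbingEmbedding

variable {S : Finset U} {f : U → V} {Q : Finset U} {L : ℕ} {R : Rooting T}

/-- A new absorber `q` can be added that serves a large proportion of the weight of all triples. -/
theorem exists_insert {γ : ℝ} (hγ : 0 < γ) (hγ1 : γ ≤ 1)
    (hG : ∀ u v, 2 * γ * Fintype.card V ≤ #{w | G.Adj u w ∧ G.Adj v w})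
    {Δ : ℕ} (hΔ : ∀ v, #{w | T.Adj v w} ≤ Δ)
    (h : AbsorbingEmbedding G T S f Q 0) (hS : R.Closed S)
    (hcard : (#S : ℝ) + Δ + 3 ≤ γ * Fintype.card V) {q : U} (hq2 : R.par (R.par q) ∉ S)
    (hq3 : R.par (R.par (R.par q)) ∈ S) (w : V × V × V → ℝ) (hw : ∀ e, 0 ≤ w e) :
    ∃ (f' : U → V) (S' : Finset U), AbsorbingEmbedding G T S' f' (insert q Q) 0 ∧ R.Closed S' ∧
      S' ⊆ insert q (insert (R.par q) (insert (R.par (R.par q)) (S ∪ ({p | T.Adj q p} : Finset U)))) ∧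
      #S' ≤ #S + Δ + 3 ∧ (∀ a ∈ S, f' a = f a) ∧ q ∉ S ∧
      γ ^ (Δ + 2) * ∑ e, w e ≤ ∑ e with IsAbsorber G T f' e q, w e := by
  have hq1 : R.par q ∉ S := fun h' => hq2 (hS.2 _ h')
  have hq0 : q ∉ S := fun h' => hq1 (hS.2 _ h')
  have hr2 : R.par (R.par q) ≠ R.root := fun h' => hq2 (h' ▸ hS.1)
  have hr1 : R.par q ≠ R.root := fun h' => hq1 (h' ▸ hS.1)
  have hr0 : q ≠ R.root := fun h' => hq0 (h' ▸ hS.1)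
  have hk1 := R.rk_par _ hr0
  have hk2 := R.rk_par _ hr1
  set q1 := R.par q with hq1def
  set q2 := R.par q1 with hq2def
  have hq12 : q1 ≠ q2 := fun h' => by rw [← h'] at hk2; omega
  have hq01 : q ≠ q1 := fun h' => by rw [← h'] at hk1; omega
  have hq02 : q ≠ q2 := fun h' => by rw [← h'] at hk2; omega
  have havail : ∀ u v (X : Finset V), #X ≤ #S + Δ + 3 →
      γ * Fintype.card V ≤ #(({w | G.Adj u w ∧ G.Adj v w} : Finset V) \ X) := by
    intro u v X hX
    have h1 := le_card_sdiff X ({w | G.Adj u w ∧ G.Adj v w} : Finset V)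
    have h2 := hG u v
    have h3 : (#{w | G.Adj u w ∧ G.Adj v w} : ℝ) - #X ≤
        #(({w | G.Adj u w ∧ G.Adj v w} : Finset V) \ X) := by
      have : #{w | G.Adj u w ∧ G.Adj v w} ≤
        #(({w | G.Adj u w ∧ G.Adj v w} : Finset V) \ X) + #X := by omega
      have : (#{w | G.Adj u w ∧ G.Adj v w} : ℝ) ≤
        #(({w | G.Adj u w ∧ G.Adj v w} : Finset V) \ X) + #X := by exact_mod_cast this
      linarith
    have h4 : (#X : ℝ) ≤ #S + Δ + 3 := by exact_mod_cast hX
    linarith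
  have hpos : 0 < γ * Fintype.card V := lt_of_lt_of_le (by positivity) hcard
  have hne : ∀ u v (X : Finset V), #X ≤ #S + Δ + 3 →
      (({w | G.Adj u w ∧ G.Adj v w} : Finset V) \ X).Nonempty := by
    intro u v X hX
    rw [← card_pos]
    exact_mod_cast hpos.trans_le (havail u v X hX)
  have him := h.card_image
  have hV : Nonempty V := by
    by_contra hV
    rw [not_nonempty_iff] at hV
    simp at hpos
  let v₀ := Classical.arbitrary V
  obtain ⟨y, hyA, hy⟩ := exists_mem_weight_le univ w hw
    (fun e => ({w | G.Adj e.1 w ∧ G.Adj e.2.1 w} : Finset V) \ S.image f)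
    (A := univ \ S.image f) ((hne v₀ v₀ (S.image f) (by omega)).mono
      (sdiff_subset_sdiff (subset_univ _) Subset.rfl))
    (fun e _ => sdiff_subset_sdiff (subset_univ _) Subset.rfl) hγ.le
    (fun e _ => havail _ _ _ (by omega))
  have hcy := card_insert_le y (S.image f)
  obtain ⟨z, hzA, hz⟩ := exists_mem_weight_le _ w hw
    (fun e => ({w | G.Adj e.2.2 w ∧ G.Adj y w} : Finset V) \ insert y (S.image f))
    (A := ({w | G.Adj y w} : Finset V) \ insert y (S.image f))
    ((hne y y (insert y (S.image f)) (by omega)).mono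
      (sdiff_subset_sdiff (fun w => by simp) Subset.rfl))
    (fun e _ => sdiff_subset_sdiff (fun w => by simp) Subset.rfl) hγ.le
    (fun e (_ : e ∈ ({e | y ∈ ({w | G.Adj e.1 w ∧ G.Adj e.2.1 w} : Finset V) \ S.image f} :
      Finset (V × V × V))) => havail _ _ _ (by omega))
  set Ω := ({e ∈ ({e | y ∈ ({w | G.Adj e.1 w ∧ G.Adj e.2.1 w} : Finset V) \ S.image f} :
      Finset (V × V × V)) | z ∈ ({w | G.Adj e.2.2 w ∧ G.Adj y w} : Finset V) \
        insert y (S.image f)}) with hΩ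
  have hΩw : γ ^ 2 * ∑ e, w e ≤ ∑ e ∈ Ω, w e := by
    refine le_trans ?_ hz
    calc γ ^ 2 * ∑ e, w e = γ * (γ * ∑ e, w e) := by ring
      _ ≤ _ := mul_le_mul_of_nonneg_left hy hγ.le
  have hcz := card_insert_le z (insert y (S.image f))
  obtain ⟨x, hx⟩ := hne (f (R.par q2)) z (insert z (insert y (S.image f))) (by omega)
  simp only [mem_sdiff, mem_univ, true_and, mem_filter, mem_insert, not_or] at hyA hzA hx
  obtain ⟨hyz, hzy, hzim⟩ := hzA
  obtain ⟨⟨hx1, hxz⟩, hxnz, hxny, hxim⟩ := hx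
  have h1 := h.extend hS hq2 hq3 hxim hx1
  have hS1 : R.Closed (insert q2 S) := hS.insert_attached hq3
  have ht1 : q1 ∉ insert q2 S := by simp [hq12, hq1]
  have h2 := h1.extend (y := z) hS1 ht1 (mem_insert_self _ _)
    (by rw [image_insert_update hq2]; simp [hzim, Ne.symm hxnz])
    (by rw [← hq2def, Function.update_self]; exact hxz.symm)
  have hS2 : R.Closed (insert q1 (insert q2 S)) := hS1.insert_attached (mem_insert_self _ _)
  have ht2 : q ∉ insert q1 (insert q2 S) := by simp [hq01, hq02, hq0]
  have h3 := h2.extend (y := y) hS2 ht2 (mem_insert_self _ _)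
    (by rw [image_insert_update ht1, image_insert_update hq2]; simp [hyA, Ne.symm hxny, Ne.symm hzy])
    (by rw [← hq1def, Function.update_self]; exact hyz.symm)
  have hS3 : R.Closed (insert q (insert q1 (insert q2 S))) :=
    hS2.insert_attached (mem_insert_self _ _)
  have hcS3 : #(insert q (insert q1 (insert q2 S))) = #S + 3 := by
    rw [card_insert_of_notMem ht2, card_insert_of_notMem ht1, card_insert_of_notMem hq2]
  set f3 := Function.update (Function.update (Function.update f q2 x) q1 z) q y with hf3
  set S3 := insert q (insert q1 (insert q2 S)) with hS3def
  have hf3q : f3 q = y := Function.update_self ..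
  have hf3q1 : f3 q1 = z := by
    rw [hf3, Function.update_of_ne hq01.symm, Function.update_self]
  have hf3S : ∀ a ∈ S, f3 a = f a := fun a ha => by
    rw [hf3, Function.update_of_ne (ne_of_mem_of_not_mem ha hq0),
      Function.update_of_ne (ne_of_mem_of_not_mem ha hq1),
      Function.update_of_ne (ne_of_mem_of_not_mem ha hq2)]
  have hqS3 : q ∈ S3 := mem_insert_self _ _
  set K : Finset U := {p | T.Adj q p ∧ p ≠ q1} with hK
  have hKΔ : #K ≤ Δ := (card_le_card fun p hp => by
    simp only [hK, mem_filter, mem_univ, true_and] at hp ⊢; exact hp.1).trans (hΔ q)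
  have hKS3 : ∀ c ∈ K, c ∉ S3 ∧ R.par c = q := by
    intro c hc
    simp only [hK, mem_filter, mem_univ, true_and] at hc
    refine ⟨fun hcS => ?_, ?_⟩
    · rcases mem_insert.1 hcS with rfl | hcS
      · exact hc.1.ne rfl
      · exact hc.2 (hS2.eq_par_of_adj hcS ht2 hc.1.symm)
    · rcases R.par_of_adj _ _ hc.1 with ⟨_, h'⟩ | ⟨_, h'⟩
      · exact absurd h'.symm hc.2
      · exact h'
  have hleaves : ∀ X ⊆ K, ∃ f', AbsorbingEmbedding G T (X ∪ S3) f' Q 0 ∧ R.Closed (X ∪ S3) ∧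
      (∀ a ∈ S3, f' a = f3 a) ∧
      γ ^ #X * ∑ e ∈ Ω, w e ≤ ∑ e ∈ Ω with ∀ c ∈ X, G.Adj e.2.2 (f' c), w e := by
    intro X
    induction X using Finset.induction_on with
    | empty => exact fun _ => ⟨f3, by simpa using h3, by simpa using hS3, fun _ _ => rfl, by simp⟩
    | insert c X hcX ih =>
      intro hXK
      obtain ⟨f', hf', hcl, hff', hwt⟩ := ih ((subset_insert _ _).trans hXK)
      obtain ⟨hcS3, hpc⟩ := hKS3 c (hXK (mem_insert_self _ _))
      have hcc : c ∉ X ∪ S3 := by simp [hcX, hcS3]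
      have hXle : #X ≤ Δ := (card_le_card ((subset_insert _ _).trans hXK)).trans hKΔ
      have hcim : #((X ∪ S3).image f') ≤ #S + Δ + 3 := by
        rw [hf'.card_image]
        have := card_union_le X S3
        omega
      obtain ⟨l, hlA, hl⟩ := exists_mem_weight_le
        ({e ∈ Ω | ∀ c ∈ X, G.Adj e.2.2 (f' c)}) w hw
        (fun e => ({w | G.Adj e.2.2 w ∧ G.Adj y w} : Finset V) \ (X ∪ S3).image f')
        (A := ({w | G.Adj y w} : Finset V) \ (X ∪ S3).image f')
        ((hne y y ((X ∪ S3).image f') (by omega)).mono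
          (sdiff_subset_sdiff (fun w => by simp) Subset.rfl))
        (fun e _ => sdiff_subset_sdiff (fun w => by simp) Subset.rfl) hγ.le
        (fun e _ => havail _ _ _ (by omega))
      simp only [mem_sdiff, mem_univ, true_and, mem_filter] at hlA
      have hpm : R.par c ∈ X ∪ S3 := by rw [hpc]; exact mem_union_right _ hqS3
      refine ⟨Function.update f' c l, ?_, ?_, ?_, ?_⟩
      · rw [insert_union]
        refine hf'.extend hcl hcc hpm hlA.2 ?_
        rw [hpc, hff' q hqS3, hf3q]
        exact hlA.1
      · rw [insert_union]; exact hcl.insert_attached hpm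
      · intro a ha
        rw [Function.update_of_ne (ne_of_mem_of_not_mem ha hcS3), hff' a ha]
      · rw [card_insert_of_notMem hcX]
        calc γ ^ (#X + 1) * ∑ e ∈ Ω, w e = γ * (γ ^ #X * ∑ e ∈ Ω, w e) := by ring
          _ ≤ γ * ∑ e ∈ Ω with ∀ c ∈ X, G.Adj e.2.2 (f' c), w e :=
              mul_le_mul_of_nonneg_left hwt hγ.le
          _ ≤ _ := hl
          _ ≤ _ := by
              refine sum_le_sum_of_subset_of_nonneg (fun e he => ?_) fun e _ _ => hw e
              simp only [mem_filter, mem_sdiff, mem_univ, true_and] at he ⊢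
              refine ⟨he.1.1, fun d hd => ?_⟩
              rcases mem_insert.1 hd with rfl | hd
              · rw [Function.update_self]; exact he.2.1.1
              · rw [Function.update_of_ne (ne_of_mem_of_not_mem hd hcX)]; exact he.1.2 d hd
  obtain ⟨f', hf', hcl, hff', hwt⟩ := hleaves K Subset.rfl
  have hnbr : ∀ p, T.Adj q p → p = q1 ∨ p ∈ K := fun p hp => by
    by_cases hpq : p = q1
    · exact Or.inl hpq
    · right; simp [hK, hp, hpq]
  have hSS3 : S ⊆ S3 := fun a ha => by simp [hS3def, ha]
  have hq1S3 : q1 ∈ S3 := by simp [hS3def]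
  refine ⟨f', K ∪ S3, ⟨hf'.inj, hf'.hom, ?_, ?_, fun _ => Nat.zero_le _⟩, hcl, ?_, ?_, ?_, hq0, ?_⟩
  · intro q' hq'
    rcases mem_insert.1 hq' with rfl | hq'
    · exact mem_union_right _ hqS3
    · exact hf'.mem q' hq'
  · intro q' hq' p hp
    rcases mem_insert.1 hq' with rfl | hq'
    · have hpS : p ∉ S := by
        rcases hnbr p hp with rfl | hpK
        · exact hq1
        · exact fun h' => (hKS3 p hpK).1 (hSS3 h')
      refine ⟨?_, ?_⟩
      · rcases hnbr p hp with rfl | hpK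
        · exact mem_union_right _ hq1S3
        · exact mem_union_left _ hpK
      · rw [mem_insert, not_or]
        exact ⟨hp.ne', fun h' => hpS (h.mem p h')⟩
    · refine ⟨(hf'.nbr q' hq' p hp).1, ?_⟩
      rw [mem_insert, not_or]
      exact ⟨fun h' => hq0 (h' ▸ (h.nbr q' hq' p hp).1), (h.nbr q' hq' p hp).2⟩
  · intro a ha
    simp only [hK, hS3def, mem_union, mem_filter, mem_univ, true_and, mem_insert] at ha ⊢
    tauto
  · have := card_union_le K S3
    omega
  · exact fun a ha => (hff' a (hSS3 ha)).trans (hf3S a ha)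
  · have hW : 0 ≤ ∑ e, w e := sum_nonneg fun e _ => hw e
    calc γ ^ (Δ + 2) * ∑ e, w e ≤ γ ^ (#K + 2) * ∑ e, w e := by
          refine mul_le_mul_of_nonneg_right (pow_le_pow_of_le_one hγ.le hγ1 (by omega)) hW
      _ = γ ^ #K * (γ ^ 2 * ∑ e, w e) := by ring
      _ ≤ γ ^ #K * ∑ e ∈ Ω, w e := mul_le_mul_of_nonneg_left hΩw (by positivity)
      _ ≤ _ := hwt
      _ ≤ _ := by
          refine sum_le_sum_of_subset_of_nonneg (fun e he => ?_) fun e _ _ => hw e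
          simp only [hΩ, mem_filter, mem_sdiff, mem_univ, true_and] at he
          simp only [mem_filter, mem_univ, true_and]
          refine ⟨?_, ?_, fun p hp => ?_⟩
          · rw [hff' q hqS3, hf3q]; exact he.1.1.1.1
          · rw [hff' q hqS3, hf3q]; exact he.1.1.1.2
          · rcases hnbr p hp with rfl | hpK
            · rw [hff' q1 hq1S3, hf3q1]; exact he.1.2.1.1
            · exact he.2 p hpK

end AbsorbingEmbedding

end Embedding

/-- In a large closed set there is a vertex whose third ancestor, but not the second one, lies in
a given small closed set. -/
theorem Rooting.Closed.exists_third_par_mem {U : Type*} [Fintype U] {T : SimpleGraph U}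
    {R : Rooting T} {Δ : ℕ} (hΔ : ∀ v, #{w | T.Adj v w} ≤ Δ) {S C : Finset U} (hS : R.Closed S)
    (hC : R.Closed C) (hcard : (Δ + 1) ^ 2 * #S < #C) :
    ∃ q ∈ C, R.par (R.par q) ∉ S ∧ R.par (R.par (R.par q)) ∈ S := by
  have hne : ({q ∈ C | R.par (R.par q) ∉ S}).Nonempty := by
    rw [filter_nonempty_iff]
    by_contra! hcon
    have h1 := Rooting.card_le_of_par_mem (R := R) hΔ (S := S)
      (C := ({v | R.par v ∈ S} : Finset U)) (by simp)
    have h2 := Rooting.card_le_of_par_mem (R := R) hΔ (S := ({v | R.par v ∈ S} : Finset U))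
      (C := C) (by simpa using hcon)
    have h3 := Nat.mul_le_mul_left (Δ + 1) h1
    rw [← mul_assoc, ← sq] at h3
    omega
  obtain ⟨q, hq, hmin⟩ := exists_min_image _ R.rk hne
  rw [mem_filter] at hq
  refine ⟨q, hq.1, hq.2, ?_⟩
  by_contra hq3
  have hr : q ≠ R.root := by
    rintro rfl
    apply hq.2
    rw [R.par_root, R.par_root]
    exact hS.1
  have h1 := hmin (R.par q) (mem_filter.2 ⟨hC.2 _ hq.1, hq3⟩)
  have h2 := R.rk_par q hr
  omega

section Embedding

variable {U V : Type*} [Fintype U] [Fintype V] {T : SimpleGraph U} {G : SimpleGraph V}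

namespace AbsorbingEmbedding

variable {R : Rooting T}

/-- Absorbers can be added one after the other, decreasing the total weight of badly served
triples by a constant factor each time. -/
theorem exists_weight_le {γ : ℝ} (hγ : 0 < γ) (hγ1 : γ ≤ 1)
    (hG : ∀ u v, 2 * γ * Fintype.card V ≤ #{w | G.Adj u w ∧ G.Adj v w})
    {Δ : ℕ} (hΔ : ∀ v, #{w | T.Adj v w} ≤ Δ) {C : Finset U} (hC : R.Closed C)
    (hCn : ∀ w ∈ C, w ≠ R.root → ∀ b, T.Adj w b → b ∈ C) (j : ℕ)
    (hj : (Δ + 1) ^ 2 * (j * (Δ + 3) + 1) < #C)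
    (hjV : (j * (Δ + 3) + 1 : ℝ) ≤ γ * Fintype.card V) :
    ∃ (S : Finset U) (f : U → V) (Q : Finset U), AbsorbingEmbedding G T S f Q 0 ∧ R.Closed S ∧
      S ⊆ C ∧ #S ≤ j * (Δ + 3) + 1 ∧
      ∑ e, (1 / 2 : ℝ) ^ #{q ∈ Q | IsAbsorber G T f e q} ≤
        (Fintype.card V : ℝ) ^ 3 * (1 - γ ^ (Δ + 2) / 2) ^ j := by
  induction j with
  | zero =>
    have hV : Nonempty V := by
      by_contra hV
      rw [not_nonempty_iff] at hV
      norm_num at hjV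
    refine ⟨{R.root}, fun _ => Classical.arbitrary V, ∅, ⟨?_, ?_, by simp, by simp, by simp⟩,
      ⟨mem_singleton_self _, ?_⟩, ?_, by simp, ?_⟩
    · intro a ha b hb _
      rw [mem_singleton.1 ha, mem_singleton.1 hb]
    · intro a ha b hb hab
      rw [mem_singleton.1 ha, mem_singleton.1 hb] at hab
      exact absurd hab (T.loopless.irrefl _)
    · intro v hv
      rw [mem_singleton.1 hv, R.par_root]
      exact mem_singleton_self _
    · exact singleton_subset_iff.2 hC.1
    · simp only [filter_empty, card_empty, pow_zero, sum_const, card_univ, Fintype.card_prod,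
        nsmul_eq_mul, mul_one]
      push_cast
      exact le_of_eq (by ring)
  | succ j ih =>
    have e1 : (j + 1) * (Δ + 3) + 1 = j * (Δ + 3) + 1 + Δ + 3 := by ring
    have hle : (Δ + 1) ^ 2 * (j * (Δ + 3) + 1) ≤ (Δ + 1) ^ 2 * ((j + 1) * (Δ + 3) + 1) :=
      Nat.mul_le_mul_left _ (by omega)
    push_cast at hjV
    have hjV' : (j * (Δ + 3) + 1 : ℝ) + Δ + 3 ≤ γ * Fintype.card V := by linarith
    obtain ⟨S, f, Q, h, hS, hSC, hcS, hw⟩ := ih (by omega) (by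
      have : (0 : ℝ) ≤ Δ := Nat.cast_nonneg _
      linarith)
    obtain ⟨q, hqC, hq2, hq3⟩ := hS.exists_third_par_mem hΔ hC
      ((Nat.mul_le_mul_left _ hcS).trans_lt (by omega))
    have hcS' : (#S : ℝ) ≤ j * (Δ + 3) + 1 := by exact_mod_cast hcS
    obtain ⟨f', S', h', hS', hsub, hcS1, hff, hqS, hw'⟩ := h.exists_insert hγ hγ1 hG hΔ hS
      (by linarith) hq2 hq3 (fun e => (1 / 2 : ℝ) ^ #{q ∈ Q | IsAbsorber G T f e q})
      fun e => by positivity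
    have hqr : q ≠ R.root := fun h' => hqS (h' ▸ hS.1)
    refine ⟨S', f', insert q Q, h', hS', hsub.trans ?_, by omega, ?_⟩
    · simp only [insert_subset_iff, union_subset_iff]
      refine ⟨hqC, hC.2 _ hqC, hC.2 _ (hC.2 _ hqC), hSC, fun b hb => ?_⟩
      simp only [mem_filter, mem_univ, true_and] at hb
      exact hCn q hqC hqr b hb
    · have hqQ : q ∉ Q := fun h1 => hqS (h.mem q h1)
      have hold : ∀ e, ({q ∈ Q | IsAbsorber G T f' e q} : Finset U) =
          {q ∈ Q | IsAbsorber G T f e q} := by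
        refine fun e => filter_congr fun q' hq' => isAbsorber_congr (hff _ (h.mem q' hq')) ?_
        exact fun p hp => hff _ (h.nbr q' hq' p hp).1
      have hnew : ∀ e, (1 / 2 : ℝ) ^ #{q ∈ insert q Q | IsAbsorber G T f' e q} =
          (1 / 2 : ℝ) ^ #{q ∈ Q | IsAbsorber G T f e q} - 1 / 2 *
            (if IsAbsorber G T f' e q then (1 / 2 : ℝ) ^ #{q ∈ Q | IsAbsorber G T f e q} else 0) := by
        intro e
        rw [filter_insert, hold]
        split_ifs with hab
        · rw [card_insert_of_notMem (by simp [hqQ]), pow_succ]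
          ring
        · ring
      simp only [hnew]
      rw [sum_sub_distrib, ← mul_sum, ← sum_filter]
      have hc : 0 ≤ 1 - γ ^ (Δ + 2) / 2 := by
        have := pow_le_one₀ (n := Δ + 2) hγ.le hγ1
        linarith
      calc _ ≤ (1 - γ ^ (Δ + 2) / 2) * ∑ e, (1 / 2 : ℝ) ^ #{q ∈ Q | IsAbsorber G T f e q} := by
            linarith
        _ ≤ (1 - γ ^ (Δ + 2) / 2) * ((Fintype.card V : ℝ) ^ 3 * (1 - γ ^ (Δ + 2) / 2) ^ j) :=
            mul_le_mul_of_nonneg_left hw hc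
        _ = _ := by ring

/-- A linear number of absorbers for every triple can be embedded inside `C`. -/
theorem exists_absorbing {γ : ℝ} (hγ : 0 < γ) (hγ1 : γ ≤ 1)
    (hG : ∀ u v, 2 * γ * Fintype.card V ≤ #{w | G.Adj u w ∧ G.Adj v w})
    {Δ : ℕ} (hΔ : ∀ v, #{w | T.Adj v w} ≤ Δ) {C : Finset U} (hC : R.Closed C)
    (hCn : ∀ w ∈ C, w ≠ R.root → ∀ b, T.Adj w b → b ∈ C) {j L : ℕ}
    (hj : (Δ + 1) ^ 2 * (j * (Δ + 3) + 1) < #C)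
    (hjV : (j * (Δ + 3) + 1 : ℝ) ≤ γ * Fintype.card V) (hCV : (#C : ℝ) ≤ 2 * γ * Fintype.card V)
    (hL : L + 3 * Real.log (Fintype.card V) ≤ γ ^ (Δ + 2) / 2 * j) :
    ∃ (f : U → V) (Q : Finset U), AbsorbingEmbedding G T C f Q L := by
  obtain ⟨S, f, Q, h, hS, hSC, -, hw⟩ := exists_weight_le hγ hγ1 hG hΔ hC hCn j hj hjV
  have hVpos : (0 : ℝ) < Fintype.card V := by
    have h1 : (0 : ℝ) < γ * Fintype.card V := lt_of_lt_of_le (by positivity) hjV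
    exact pos_of_mul_pos_right h1 hγ.le
  have hcount : ∀ e, L ≤ #{q ∈ Q | IsAbsorber G T f e q} := by
    intro e
    have h1 : (1 / 2 : ℝ) ^ #{q ∈ Q | IsAbsorber G T f e q} ≤
        (Fintype.card V : ℝ) ^ 3 * (1 - γ ^ (Δ + 2) / 2) ^ j :=
      (single_le_sum (f := fun e => (1 / 2 : ℝ) ^ #{q ∈ Q | IsAbsorber G T f e q})
        (fun e _ => by positivity) (mem_univ e)).trans hw
    have h2 : (1 - γ ^ (Δ + 2) / 2) ^ j ≤ Real.exp (-(γ ^ (Δ + 2) / 2 * j)) := by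
      have := Real.one_sub_le_exp_neg (γ ^ (Δ + 2) / 2)
      have hc : 0 ≤ 1 - γ ^ (Δ + 2) / 2 := by
        have := pow_le_one₀ (n := Δ + 2) hγ.le hγ1
        linarith
      calc _ ≤ Real.exp (-(γ ^ (Δ + 2) / 2)) ^ j := pow_le_pow_left₀ hc this j
        _ = _ := by rw [← Real.exp_nat_mul]; ring_nf
    have h3 : (Fintype.card V : ℝ) ^ 3 = Real.exp (3 * Real.log (Fintype.card V)) := by
      rw [show (3 : ℝ) = ((3 : ℕ) : ℝ) by norm_num, Real.exp_nat_mul, Real.exp_log hVpos]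
    have h4 : (1 / 2 : ℝ) ^ #{q ∈ Q | IsAbsorber G T f e q} ≤ Real.exp (-L) := by
      calc _ ≤ _ := h1
        _ ≤ Real.exp (3 * Real.log (Fintype.card V)) * Real.exp (-(γ ^ (Δ + 2) / 2 * j)) := by
            rw [h3]
            exact mul_le_mul_of_nonneg_left h2 (Real.exp_nonneg _)
        _ ≤ _ := by
            rw [← Real.exp_add]
            exact Real.exp_le_exp.2 (by linarith)
    have h5 : Real.exp (-(#{q ∈ Q | IsAbsorber G T f e q} : ℝ)) ≤
        (1 / 2 : ℝ) ^ #{q ∈ Q | IsAbsorber G T f e q} := by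
      rw [show -(#{q ∈ Q | IsAbsorber G T f e q} : ℝ) =
        (#{q ∈ Q | IsAbsorber G T f e q} : ℝ) * (-1) by ring, Real.exp_nat_mul]
      refine pow_le_pow_left₀ (Real.exp_nonneg _) ?_ _
      rw [Real.exp_neg, one_div]
      gcongr
      have := Real.add_one_le_exp 1
      linarith
    have h6 := Real.exp_le_exp.1 (h5.trans h4)
    exact_mod_cast neg_le_neg_iff.1 h6
  have h' : AbsorbingEmbedding G T S f Q L := ⟨h.inj, h.hom, h.mem, h.nbr, hcount⟩
  have hd : ∀ u, #C ≤ #{w | G.Adj u w} := fun u => by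
    have h1 := hCV.trans (hG u u)
    simp only [and_self] at h1
    exact_mod_cast h1
  obtain ⟨f', hf'⟩ := h'.extend_greedy hd hC le_rfl hS hSC
  exact ⟨f', Q, hf'⟩

end AbsorbingEmbedding

end Embedding

section Tiling

variable {V : Type*} {G : SimpleGraph V}

/-- `X` is a disjoint union of copies of the complete bipartite graph with sides of size `t`. -/
inductive Tileable (G : SimpleGraph V) (t : ℕ) : Finset V → Prop
  | empty : Tileable G t ∅
  | add {A B X : Finset V} (hA : #A = t) (hB : #B = t) (hAB : ∀ a ∈ A, ∀ b ∈ B, G.Adj a b)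
      (hX : Disjoint (A ∪ B) X) (h : Tileable G t X) : Tileable G t (A ∪ B ∪ X)

theorem SimpleGraph.disjoint_of_forall_adj {A B : Finset V} (hAB : ∀ a ∈ A, ∀ b ∈ B, G.Adj a b) :
    Disjoint A B := by
  rw [Finset.disjoint_left]
  intro a ha hb
  exact (hAB a ha a hb).ne rfl

namespace Tileable

theorem union {t : ℕ} {X Y : Finset V} (hX : Tileable G t X) (hY : Tileable G t Y)
    (h : Disjoint X Y) : Tileable G t (X ∪ Y) := by
  induction hX with
  | empty => simpa using hY
  | add hA hB hAB hd _ ih =>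
    rw [disjoint_union_left] at h
    rw [union_assoc]
    exact add hA hB hAB (disjoint_union_right.2 ⟨hd, h.1⟩) (ih h.2)

theorem of_complete {t m : ℕ} {A B : Finset V} (hA : #A = m * t) (hB : #B = m * t)
    (hAB : ∀ a ∈ A, ∀ b ∈ B, G.Adj a b) : Tileable G t (A ∪ B) := by
  induction m generalizing A B with
  | zero =>
    rw [zero_mul, card_eq_zero] at hA hB
    rw [hA, hB]
    exact empty
  | succ m ih =>
    rw [add_mul, one_mul] at hA hB
    obtain ⟨A', hA', hcA⟩ := exists_subset_card_eq (s := A) (n := t) (by omega)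
    obtain ⟨B', hB', hcB⟩ := exists_subset_card_eq (s := B) (n := t) (by omega)
    have hd := G.disjoint_of_forall_adj hAB
    have h1 := ih (A := A \ A') (B := B \ B') (by rw [card_sdiff_of_subset hA']; omega)
      (by rw [card_sdiff_of_subset hB']; omega)
      fun a ha b hb => hAB a (mem_sdiff.1 ha).1 b (mem_sdiff.1 hb).1
    have h2 := add hcA hcB (fun a ha b hb => hAB a (hA' ha) b (hB' hb)) (X := A \ A' ∪ B \ B') (by
      rw [disjoint_left] at hd ⊢
      intro x hx hx'
      simp only [mem_union, mem_sdiff] at hx hx'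
      have := @hA' x
      have := @hB' x
      have := @hd x
      tauto) h1
    convert h2 using 1
    ext x
    simp only [mem_union, mem_sdiff]
    have := @hA' x
    have := @hB' x
    tauto

theorem of_mul {t m : ℕ} {X : Finset V} (hX : Tileable G (m * t) X) : Tileable G t X := by
  induction hX with
  | empty => exact empty
  | add hA hB hAB hd _ ih => exact (of_complete hA hB hAB).union ih hd

/-- A weight of average at least `θ` on `X` has average at least `θ` on some tile. -/
theorem exists_tile {t : ℕ} {X : Finset V} (hX : Tileable G t X) (g : V → ℝ) {θ : ℝ}
    (h : θ * #X ≤ ∑ x ∈ X, g x) (hne : X.Nonempty) :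
    ∃ A B Y, #A = t ∧ #B = t ∧ (∀ a ∈ A, ∀ b ∈ B, G.Adj a b) ∧ Disjoint (A ∪ B) Y ∧
      Tileable G t Y ∧ X = A ∪ B ∪ Y ∧ θ * #(A ∪ B) ≤ ∑ x ∈ A ∪ B, g x := by
  induction hX with
  | empty => exact absurd rfl hne.ne_empty
  | @add A B X hA hB hAB hd hX ih =>
    by_cases hg : θ * #(A ∪ B) ≤ ∑ x ∈ A ∪ B, g x
    · exact ⟨A, B, X, hA, hB, hAB, hd, hX, rfl, hg⟩
    · rw [card_union_of_disjoint hd, sum_union hd] at h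
      push_cast at h hg
      have h' : θ * #X < ∑ x ∈ X, g x := by linarith
      obtain ⟨A', B', Y, hA', hB', hAB', hd', hY, rfl, hg'⟩ := ih h'.le (by
        by_contra hcon
        rw [not_nonempty_iff_eq_empty] at hcon
        simp [hcon] at h')
      rw [disjoint_union_right] at hd
      refine ⟨A', B', A ∪ B ∪ Y, hA', hB', hAB', disjoint_union_right.2 ⟨hd.1.symm, hd'⟩,
        add hA hB hAB hd.2 hY, ?_, hg'⟩
      exact union_left_comm _ _ _

end Tileable

/-- Double counting and the pigeonhole principle: many vertices of `W` share a large set of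
neighbours in `X`. -/
theorem SimpleGraph.exists_common_neighbors {X W : Finset V} (hX : X.Nonempty) (hW : W.Nonempty)
    {θ β : ℝ} (hθ : 0 ≤ θ) (hβ : 0 < β)
    (h : (θ + β) * #X * #W ≤ ∑ x ∈ X, (#{w ∈ W | G.Adj x w} : ℝ)) :
    ∃ S ⊆ X, ∃ W' ⊆ W, θ * #X ≤ #S ∧ β * #W ≤ 2 ^ #X * #W' ∧ ∀ x ∈ S, ∀ w ∈ W', G.Adj x w := by
  have hXpos : (0 : ℝ) < #X := by exact_mod_cast hX.card_pos
  have hWpos : (0 : ℝ) < #W := by exact_mod_cast hW.card_pos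
  have hsw : ∑ x ∈ X, (#{w ∈ W | G.Adj x w} : ℝ) = ∑ w ∈ W, (#{x ∈ X | G.Adj x w} : ℝ) := by
    exact_mod_cast sum_card_bipartiteAbove_eq_sum_card_bipartiteBelow (s := X) (t := W) G.Adj
  set good : Finset V := {w ∈ W | θ * #X ≤ #{x ∈ X | G.Adj x w}} with hgood
  have h1 : ∑ w ∈ W, (#{x ∈ X | G.Adj x w} : ℝ) ≤ θ * #X * #W + #X * #good := by
    calc ∑ w ∈ W, (#{x ∈ X | G.Adj x w} : ℝ)
        ≤ ∑ w ∈ W, (θ * #X + if θ * #X ≤ #{x ∈ X | G.Adj x w} then (#X : ℝ) - θ * #X else 0) := by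
          refine sum_le_sum fun w _ => ?_
          split_ifs with hw
          · have : (#{x ∈ X | G.Adj x w} : ℝ) ≤ #X := by exact_mod_cast card_filter_le _ _
            linarith
          · linarith
      _ = θ * #X * #W + (#X - θ * #X) * #good := by
          rw [sum_add_distrib, ← sum_filter, sum_const, sum_const, nsmul_eq_mul, nsmul_eq_mul]
          ring
      _ ≤ _ := by
          gcongr
          exact sub_le_self _ (by positivity)
  have h2 : β * #W ≤ #good := by
    rw [hsw] at h
    have : #X * (β * #W) ≤ #X * (#good : ℝ) := by nlinarith
    exact le_of_mul_le_mul_left this hXpos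
  obtain ⟨S, hS, hcS⟩ := exists_le_card_fiber_of_nsmul_le_card_of_maps_to (s := good)
    (t := X.powerset) (f := fun w => {x ∈ X | G.Adj x w}) (b := β * #W / 2 ^ #X)
    (fun w _ => mem_powerset.2 (filter_subset _ _)) (powerset_nonempty _) (by
      rw [card_powerset, nsmul_eq_mul]
      push_cast
      rwa [mul_div_cancel₀ _ (by positivity)])
  set W' : Finset V := {w ∈ good | ({x ∈ X | G.Adj x w} : Finset V) = S} with hW'
  have hW'S : ∀ w ∈ W', θ * #X ≤ #S ∧ ∀ x ∈ S, G.Adj x w := by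
    intro w hw
    rw [hW', mem_filter, hgood, mem_filter] at hw
    refine ⟨hw.2 ▸ hw.1.2, fun x hx => ?_⟩
    rw [← hw.2, mem_filter] at hx
    exact hx.2
  have hW'ne : W'.Nonempty := by
    rw [← card_pos]
    have : (0 : ℝ) < β * #W / 2 ^ #X := by positivity
    exact_mod_cast this.trans_le hcS
  obtain ⟨w, hw⟩ := hW'ne
  refine ⟨S, mem_powerset.1 hS, W', fun w hw => ?_, (hW'S w hw).1, ?_, fun x hx w hw =>
    (hW'S w hw).2 x hx⟩
  · rw [hW', mem_filter, hgood, mem_filter] at hw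
    exact hw.1.1
  · rwa [div_le_iff₀' (by positivity)] at hcS

end Tiling

section Tiling

variable {V : Type*} {G : SimpleGraph V}

/-- A dense graph contains a complete bipartite graph. -/
theorem SimpleGraph.exists_complete_of_dense {W : Finset V} {β : ℝ} (hβ : 0 < β) {t M : ℕ}
    (hM : 0 < M) (htM : 4 * t ≤ β * M) (h1 : 2 * M ≤ β * #W) (h2 : 4 * t * 2 ^ M ≤ β * #W)
    (h : β * #W * #W ≤ ∑ w ∈ W, (#{w' ∈ W | G.Adj w w'} : ℝ)) :
    ∃ A ⊆ W, ∃ B ⊆ W, #A = t ∧ #B = t ∧ ∀ a ∈ A, ∀ b ∈ B, G.Adj a b := by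
  have hMr : (0 : ℝ) < M := by exact_mod_cast hM
  have hWpos : (0 : ℝ) < #W := pos_of_mul_pos_right (by linarith : 0 < β * #W) hβ.le
  have hWne : W.Nonempty := card_pos.1 (by exact_mod_cast hWpos)
  set H : Finset V := {w ∈ W | β / 2 * #W ≤ #{w' ∈ W | G.Adj w w'}} with hH
  have hcH : β / 2 * #W ≤ #H := by
    have : ∑ w ∈ W, (#{w' ∈ W | G.Adj w w'} : ℝ) ≤ β / 2 * #W * #W + #W * #H := by
      calc ∑ w ∈ W, (#{w' ∈ W | G.Adj w w'} : ℝ)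
          ≤ ∑ w ∈ W, (β / 2 * #W + if β / 2 * #W ≤ #{w' ∈ W | G.Adj w w'} then (#W : ℝ) else 0) := by
            refine sum_le_sum fun w _ => ?_
            split_ifs with hw
            · have : (#{w' ∈ W | G.Adj w w'} : ℝ) ≤ #W := by exact_mod_cast card_filter_le _ _
              have : 0 ≤ β / 2 * #W := by positivity
              linarith
            · linarith
        _ = _ := by
            rw [sum_add_distrib, ← sum_filter, sum_const, sum_const, nsmul_eq_mul, nsmul_eq_mul]
            ring
    have : #W * (β / 2 * #W) ≤ #W * (#H : ℝ) := by nlinarith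
    exact le_of_mul_le_mul_left this hWpos
  obtain ⟨X, hXH, hcX⟩ := exists_subset_card_eq (s := H) (n := M) (by
    have : (M : ℝ) ≤ #H := by linarith
    exact_mod_cast this)
  obtain ⟨S, hSX, W', hW', hcS, hcW', hadj⟩ := G.exists_common_neighbors (X := X) (W := W)
    (card_pos.1 (by omega)) hWne (θ := β / 4) (β := β / 4) (by positivity) (by positivity) (by
      calc (β / 4 + β / 4) * #X * #W = ∑ x ∈ X, β / 2 * #W := by
            rw [sum_const, nsmul_eq_mul]; ring
        _ ≤ _ := sum_le_sum fun x hx => (mem_filter.1 (hXH hx)).2)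
  rw [hcX] at hcS hcW'
  obtain ⟨A, hA, hcA⟩ := exists_subset_card_eq (s := S) (n := t) (by
    have : (t : ℝ) ≤ #S := by linarith
    exact_mod_cast this)
  obtain ⟨B, hB, hcB⟩ := exists_subset_card_eq (s := W') (n := t) (by
    have h3 : (2 : ℝ) ^ M * t ≤ 2 ^ M * #W' := by linarith
    exact_mod_cast le_of_mul_le_mul_left h3 (by positivity))
  exact ⟨A, fun a ha => (mem_filter.1 (hXH (hSX (hA ha)))).1, B, hB.trans hW', hcA, hcB,
    fun a ha b hb => hadj a (hA ha) b (hB hb)⟩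

namespace Tileable

/-- A tile with many edges to `W` can be split into smaller tiles that together with
`2 * s` vertices of `W` can be tiled again. -/
theorem exists_augment {m s : ℕ} (hm : 0 < m) (hs : 0 < s) {A B W : Finset V} (hA : #A = m * s)
    (hB : #B = m * s) (hAB : ∀ a ∈ A, ∀ b ∈ B, G.Adj a b) (hW : Disjoint (A ∪ B) W) {β : ℝ}
    (hβ : 0 < β) (hmβ : 1 ≤ 2 * β * m) (hcW : 2 ^ (2 * (m * s)) * (2 * s) ≤ β * #W)
    (h : (1 / 2 + 2 * β) * #W * #(A ∪ B) ≤ ∑ x ∈ A ∪ B, (#{w ∈ W | G.Adj x w} : ℝ)) :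
    ∃ Y ⊆ W, #Y = 2 * s ∧ Tileable G s (A ∪ B ∪ Y) := by
  have hd := G.disjoint_of_forall_adj hAB
  have hcAB : #(A ∪ B) = 2 * (m * s) := by rw [card_union_of_disjoint hd]; omega
  have hsr : (0 : ℝ) < s := by exact_mod_cast hs
  have hms : 0 < m * s := Nat.mul_pos hm hs
  have hWpos : (0 : ℝ) < #W := pos_of_mul_pos_right
    (lt_of_lt_of_le (by positivity) hcW : 0 < β * #W) hβ.le
  obtain ⟨S, hSX, W', hW', hcS, hcW', hadj⟩ := G.exists_common_neighbors (X := A ∪ B) (W := W)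
    (card_pos.1 (by omega)) (card_pos.1 (by exact_mod_cast hWpos)) (θ := 1 / 2 + β) (β := β)
    (by positivity) hβ (by linarith)
  have hSAB : S = S ∩ A ∪ S ∩ B := by
    rw [← inter_union_distrib_left, inter_eq_left.2 hSX]
  have hcSAB : #S ≤ #(S ∩ A) + #(S ∩ B) := by
    conv_lhs => rw [hSAB]
    exact card_union_le _ _
  have hSA := card_le_card (inter_subset_right : S ∩ A ⊆ A)
  have hSB := card_le_card (inter_subset_right : S ∩ B ⊆ B)
  rw [hcAB] at hcS hcW'
  have hSr : (m * s + s : ℝ) ≤ #S := by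
    refine le_trans ?_ hcS
    push_cast
    nlinarith
  have hSn : m * s + s ≤ #S := by exact_mod_cast hSr
  obtain ⟨A', hA', hcA'⟩ := exists_subset_card_eq (s := S ∩ A) (n := s) (by omega)
  obtain ⟨B', hB', hcB'⟩ := exists_subset_card_eq (s := S ∩ B) (n := s) (by omega)
  obtain ⟨Y, hY, hcY⟩ := exists_subset_card_eq (s := W') (n := 2 * s) (by
    have h3 : (2 : ℝ) ^ (2 * (m * s)) * (2 * s : ℕ) ≤ 2 ^ (2 * (m * s)) * #W' := by
      push_cast; linarith
    exact_mod_cast le_of_mul_le_mul_left h3 (by positivity))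
  obtain ⟨Y', hY', hcY'⟩ := exists_subset_card_eq (s := Y) (n := s) (by omega)
  have hA'A : A' ⊆ A := hA'.trans inter_subset_right
  have hB'B : B' ⊆ B := hB'.trans inter_subset_right
  refine ⟨Y, hY.trans hW', hcY, ?_⟩
  have hYAB : Disjoint (A ∪ B) Y := hW.mono_right (hY.trans hW')
  obtain ⟨m, rfl⟩ : ∃ k, m = k + 1 := ⟨m - 1, by omega⟩
  rw [add_mul, one_mul] at hA hB
  have t1 : Tileable G s (A \ A' ∪ B \ B') := of_complete (m := m)
    (by rw [card_sdiff_of_subset hA'A]; omega) (by rw [card_sdiff_of_subset hB'B]; omega)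
    fun a ha b hb => hAB a (mem_sdiff.1 ha).1 b (mem_sdiff.1 hb).1
  have key : ∀ x, (x ∈ A' → x ∈ A) ∧ (x ∈ B' → x ∈ B) ∧ (x ∈ Y' → x ∈ Y) ∧
      (x ∈ A → x ∉ B) ∧ (x ∈ A → x ∉ Y) ∧ (x ∈ B → x ∉ Y) := fun x =>
    ⟨@hA'A x, @hB'B x, @hY' x, fun h => disjoint_left.1 hd h,
      fun h => disjoint_left.1 hYAB (mem_union_left _ h),
      fun h => disjoint_left.1 hYAB (mem_union_right _ h)⟩
  have t2 := add hcB' (B := Y \ Y') (by rw [card_sdiff_of_subset hY']; omega)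
    (fun b hb y hy => hadj b (mem_inter.1 (hB' hb)).1 y (hY (mem_sdiff.1 hy).1)) (by
      rw [disjoint_left]
      intro x hx hx'
      simp only [mem_union, mem_sdiff] at hx hx'
      have := key x
      grind) t1
  have t3 := add hcA' hcY'
    (fun a ha y hy => hadj a (mem_inter.1 (hA' ha)).1 y (hY (hY' hy))) (by
      rw [disjoint_left]
      intro x hx hx'
      simp only [mem_union, mem_sdiff] at hx hx'
      have := key x
      grind) t2
  convert t3 using 1
  ext x
  simp only [mem_union, mem_sdiff]
  have := key x
  grind

/-- One improvement step of a tiling by tiles of two sizes. -/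
theorem exists_improve {m s M : ℕ} (hm : 0 < m) (hs : 0 < s) {β : ℝ} (hβ : 0 < β)
    (hmβ : 1 ≤ 2 * β * m) {V₀ X₁ X₂ : Finset V}
    (hdeg : ∀ v ∈ V₀, (1 / 2 + 4 * β) * #V₀ ≤ #{w ∈ V₀ | G.Adj v w})
    (h1 : Tileable G s X₁) (h2 : Tileable G (m * s) X₂) (hd : Disjoint X₁ X₂)
    (hV1 : X₁ ⊆ V₀) (hV2 : X₂ ⊆ V₀) (hX1 : #X₁ ≤ β * #V₀)
    (hM : 0 < M) (hsM : 4 * s ≤ β * M) (hW1 : 2 * M ≤ β * #(V₀ \ (X₁ ∪ X₂)))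
    (hW2 : 4 * s * 2 ^ M ≤ β * #(V₀ \ (X₁ ∪ X₂)))
    (hW3 : 2 ^ (2 * (m * s)) * (2 * s) ≤ β * #(V₀ \ (X₁ ∪ X₂))) :
    ∃ Y₁ Y₂, Tileable G s Y₁ ∧ Tileable G (m * s) Y₂ ∧ Disjoint Y₁ Y₂ ∧ Y₁ ⊆ V₀ ∧ Y₂ ⊆ V₀ ∧
      #Y₁ ≤ #X₁ + 2 * (m + 1) * s ∧ #(Y₁ ∪ Y₂) = #(X₁ ∪ X₂) + 2 * s := by
  set W := V₀ \ (X₁ ∪ X₂) with hW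
  have hWV : W ⊆ V₀ := sdiff_subset
  have hWX : Disjoint W (X₁ ∪ X₂) := sdiff_disjoint
  rw [disjoint_union_right] at hWX
  have hMr : (0 : ℝ) < M := by exact_mod_cast hM
  have hWpos : (0 : ℝ) < #W := pos_of_mul_pos_right (by linarith : 0 < β * #W) hβ.le
  by_cases hden : β * #W * #W ≤ ∑ w ∈ W, (#{w' ∈ W | G.Adj w w'} : ℝ)
  · obtain ⟨A, hA, B, hB, hcA, hcB, hAB⟩ := G.exists_complete_of_dense hβ hM hsM hW1 hW2 hden
    have hABW : A ∪ B ⊆ W := union_subset hA hB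
    have hd1 := hWX.1.mono_left hABW
    have hd2 := hWX.2.mono_left hABW
    have hcAB : #(A ∪ B) = 2 * s := by
      rw [card_union_of_disjoint (G.disjoint_of_forall_adj hAB)]; omega
    refine ⟨A ∪ B ∪ X₁, X₂, add hcA hcB hAB hd1 h1, h2, disjoint_union_left.2 ⟨hd2, hd⟩,
      union_subset (hABW.trans hWV) hV1, hV2, ?_, ?_⟩
    · rw [card_union_of_disjoint hd1, hcAB]
      nlinarith
    · rw [union_assoc, card_union_of_disjoint (disjoint_union_right.2 ⟨hd1, hd2⟩), hcAB, add_comm]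
  · push Not at hden
    have hWV₀ : (#W : ℝ) ≤ #V₀ := by exact_mod_cast card_le_card hWV
    have hX₂V₀ : (#X₂ : ℝ) ≤ #V₀ := by exact_mod_cast card_le_card hV2
    have hsum : (1 / 2 + 2 * β) * #W * #V₀ ≤ ∑ w ∈ W, (#{x ∈ X₂ | G.Adj x w} : ℝ) := by
      have h3 : ∀ w ∈ W, (1 / 2 + 4 * β) * #V₀ ≤
          #{w' ∈ W | G.Adj w w'} + β * #V₀ + #{x ∈ X₂ | G.Adj x w} := by
        intro w hw
        have h4 : ({x ∈ V₀ | G.Adj w x} : Finset V) ⊆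
            {w' ∈ W | G.Adj w w'} ∪ X₁ ∪ ({x ∈ X₂ | G.Adj x w} : Finset V) := by
          intro x hx
          simp only [mem_filter, mem_union, hW, mem_sdiff] at hx ⊢
          have := G.adj_comm w x
          tauto
        have h5 := (card_le_card h4).trans (card_union_le _ _)
        have h6 := card_union_le ({w' ∈ W | G.Adj w w'}) X₁
        have h7 : (#{x ∈ V₀ | G.Adj w x} : ℝ) ≤
            #{w' ∈ W | G.Adj w w'} + #X₁ + #{x ∈ X₂ | G.Adj x w} := by
          exact_mod_cast h5.trans (Nat.add_le_add_right h6 _)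
        linarith [hdeg w (hWV hw)]
      have h8 := sum_le_sum h3
      rw [sum_add_distrib, sum_add_distrib, sum_const, sum_const, nsmul_eq_mul, nsmul_eq_mul] at h8
      have h9 : β * #W * #W ≤ β * #W * #V₀ := by gcongr
      linarith
    have hsw : ∑ x ∈ X₂, (#{w ∈ W | G.Adj x w} : ℝ) = ∑ w ∈ W, (#{x ∈ X₂ | G.Adj x w} : ℝ) := by
      exact_mod_cast sum_card_bipartiteAbove_eq_sum_card_bipartiteBelow (s := X₂) (t := W) G.Adj
    rw [← hsw] at hsum
    have hV₀pos : (0 : ℝ) < #V₀ := hWpos.trans_le hWV₀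
    obtain ⟨A, B, Z, hA, hB, hAB, hdZ, hZ, rfl, hg⟩ := h2.exists_tile
      (fun x => (#{w ∈ W | G.Adj x w} : ℝ)) (θ := (1 / 2 + 2 * β) * #W)
      (le_trans (by gcongr) hsum) (by
        by_contra hcon
        rw [not_nonempty_iff_eq_empty] at hcon
        rw [hcon, sum_empty] at hsum
        have : 0 < (1 / 2 + 2 * β) * #W * #V₀ := by positivity
        linarith)
    have hWAB : Disjoint (A ∪ B) W := (hWX.2.mono_right subset_union_left).symm
    obtain ⟨Y, hY, hcY, htY⟩ := exists_augment hm hs hA hB hAB hWAB hβ hmβ hW3 hg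
    rw [disjoint_union_right] at hd
    have hd1 : Disjoint (A ∪ B ∪ Y) X₁ :=
      disjoint_union_left.2 ⟨hd.1.symm, hWX.1.mono_left hY⟩
    have hYZ : Disjoint Y Z := (disjoint_union_right.1 hWX.2).2.mono_left hY
    have hYAB : Disjoint (A ∪ B) Y := hWAB.mono_right hY
    have hcAB : #(A ∪ B) = 2 * (m * s) := by
      rw [card_union_of_disjoint (G.disjoint_of_forall_adj hAB)]; omega
    refine ⟨A ∪ B ∪ Y ∪ X₁, Z, htY.union h1 hd1, hZ,
      disjoint_union_left.2 ⟨disjoint_union_left.2 ⟨hdZ, hYZ⟩, hd.2⟩,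
      union_subset (union_subset (subset_union_left.trans hV2) (hY.trans hWV)) hV1,
      subset_union_right.trans hV2, ?_, ?_⟩
    · rw [card_union_of_disjoint hd1, card_union_of_disjoint hYAB, hcAB, hcY]
      apply le_of_eq
      ring
    · have : A ∪ B ∪ Y ∪ X₁ ∪ Z = X₁ ∪ (A ∪ B ∪ Z) ∪ Y := by
        ext x; simp only [mem_union]; tauto
      rw [this, card_union_of_disjoint, hcY]
      exact disjoint_union_left.2 ⟨(hWX.1.mono_left hY).symm, (hWX.2.mono_left hY).symm⟩

end Tileable

end Tiling

namespace Tileable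

/-- A sequence of improvement steps, stopping when fewer than `K` vertices are left. -/
theorem exists_improve_many {V : Type*} {G : SimpleGraph V} {m s M : ℕ} (hm : 0 < m) (hs : 0 < s)
    {β : ℝ} (hβ : 0 < β) (hmβ : 1 ≤ 2 * β * m) {V₀ X : Finset V}
    (hdeg : ∀ v ∈ V₀, (1 / 2 + 4 * β) * #V₀ ≤ #{w ∈ V₀ | G.Adj v w})
    (hX : Tileable G (m * s) X) (hXV : X ⊆ V₀) (hM : 0 < M) (hsM : 4 * s ≤ β * M) {K : ℝ}
    (hK1 : 2 * M ≤ β * K) (hK2 : 4 * s * 2 ^ M ≤ β * K)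
    (hK3 : 2 ^ (2 * (m * s)) * (2 * s) ≤ β * K) (j : ℕ)
    (hj : 2 * (m + 1) * s * j ≤ β * #V₀) :
    ∃ Y₁ Y₂, Tileable G s Y₁ ∧ Tileable G (m * s) Y₂ ∧ Disjoint Y₁ Y₂ ∧ Y₁ ⊆ V₀ ∧ Y₂ ⊆ V₀ ∧
      #Y₁ ≤ 2 * (m + 1) * s * j ∧
      ((#(V₀ \ (Y₁ ∪ Y₂)) : ℝ) < K ∨ #X + 2 * s * j ≤ #(Y₁ ∪ Y₂)) := by
  induction j with
  | zero => exact ⟨∅, X, empty, hX, disjoint_empty_left _, empty_subset _, hXV, by simp, by simp⟩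
  | succ j ih =>
    have hle : (2 * (m + 1) * s * j : ℝ) ≤ β * #V₀ := by
      refine le_trans ?_ hj
      push_cast
      gcongr
      linarith
    obtain ⟨Y₁, Y₂, h1, h2, hd, hV1, hV2, hc1, hc⟩ := ih hle
    by_cases hW : (#(V₀ \ (Y₁ ∪ Y₂)) : ℝ) < K
    · exact ⟨Y₁, Y₂, h1, h2, hd, hV1, hV2,
        hc1.trans (Nat.mul_le_mul_left _ (Nat.le_succ j)), Or.inl hW⟩
    · have hKW := mul_le_mul_of_nonneg_left (not_lt.1 hW) hβ.le
      have hc1' : (#Y₁ : ℝ) ≤ 2 * (m + 1) * s * j := by exact_mod_cast hc1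
      obtain ⟨Z₁, Z₂, h1', h2', hd', hV1', hV2', hc1', hc'⟩ := exists_improve hm hs hβ hmβ hdeg
        h1 h2 hd hV1 hV2 (hc1'.trans hle) hM hsM (hK1.trans hKW) (hK2.trans hKW) (hK3.trans hKW)
      refine ⟨Z₁, Z₂, h1', h2', hd', hV1', hV2', ?_, Or.inr ?_⟩
      · rw [mul_add_one]
        omega
      · have := hc.resolve_left hW
        rw [mul_add_one]
        omega

/-- A graph of minimum degree well above half the number of vertices can almost be tiled by
complete bipartite graphs. -/
theorem exists_almost_tiling {β κ : ℝ} (hβ : 0 < β) (hκ : 0 < κ) {s : ℕ} (hs : 0 < s) :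
    ∃ N₀ : ℕ, ∀ (V : Type u) (G : SimpleGraph V) (V₀ : Finset V), N₀ ≤ #V₀ →
      (∀ v ∈ V₀, (1 / 2 + 4 * β) * #V₀ ≤ #{w ∈ V₀ | G.Adj v w}) →
      ∃ X ⊆ V₀, Tileable G s X ∧ (#(V₀ \ X) : ℝ) ≤ κ * #V₀ := by
  obtain ⟨m, hmβ⟩ := exists_nat_ge (1 / (2 * β))
  rw [div_le_iff₀' (by positivity)] at hmβ
  have hm : 0 < m := by
    rcases Nat.eq_zero_or_pos m with rfl | h
    · norm_num at hmβ
    · exact h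
  set η : ℝ := β / (2 * (m + 1)) with hη
  have hηpos : 0 < η := by positivity
  have main : ∀ r s : ℕ, 0 < s → ∃ N₀ : ℕ, ∀ (V : Type u) (G : SimpleGraph V) (V₀ : Finset V),
      N₀ ≤ #V₀ → (∀ v ∈ V₀, (1 / 2 + 4 * β) * #V₀ ≤ #{w ∈ V₀ | G.Adj v w}) →
      ∃ X ⊆ V₀, Tileable G s X ∧ ((#(V₀ \ X) : ℝ) ≤ κ * #V₀ ∨ r * η * #V₀ ≤ #X) := by
    intro r
    induction r with
    | zero =>
      intro s _
      exact ⟨0, fun V G V₀ _ _ => ⟨∅, empty_subset _, empty, by simp⟩⟩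
    | succ r ih =>
      intro s hs
      obtain ⟨N₁, hN₁⟩ := ih (m * s) (Nat.mul_pos hm hs)
      obtain ⟨M, hsM⟩ := exists_nat_ge (4 * s / β)
      rw [div_le_iff₀' hβ] at hsM
      have hsr : (0 : ℝ) < s := by exact_mod_cast hs
      have hM : 0 < M := by
        rcases Nat.eq_zero_or_pos M with rfl | h
        · rw [Nat.cast_zero, mul_zero] at hsM
          linarith
        · exact h
      obtain ⟨N₂, hN₂⟩ := exists_nat_ge
        ((2 * M + 4 * s * 2 ^ M + 2 ^ (2 * (m * s)) * (2 * s)) / (β * κ) + 2 * s / η)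
      refine ⟨max N₁ N₂, fun V G V₀ hV₀ hdeg => ?_⟩
      have hV₀r : (N₂ : ℝ) ≤ #V₀ := by exact_mod_cast (le_max_right _ _).trans hV₀
      have hb : (0 : ℝ) ≤ 2 * s / η := by positivity
      have hb' : (0 : ℝ) ≤ (2 * M + 4 * s * 2 ^ M + 2 ^ (2 * (m * s)) * (2 * s)) / (β * κ) := by
        positivity
      have hK : (2 * M + 4 * s * 2 ^ M + 2 ^ (2 * (m * s)) * (2 * s) : ℝ) ≤ β * (κ * #V₀) := by
        rw [← mul_assoc β κ, ← div_le_iff₀' (by positivity)]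
        linarith
      have hgain : 2 * s ≤ η * #V₀ := by
        rw [← div_le_iff₀' hηpos]
        linarith
      obtain ⟨X, hXV, hX, hcX⟩ := hN₁ V G V₀ ((le_max_left _ _).trans hV₀) hdeg
      by_cases hleft : (#(V₀ \ X) : ℝ) ≤ κ * #V₀
      · exact ⟨X, hXV, hX.of_mul, Or.inl hleft⟩
      have hcX' := hcX.resolve_left hleft
      set j := ⌊β * #V₀ / (2 * (m + 1) * s)⌋₊ with hj
      have hj1 : (j : ℝ) ≤ β * #V₀ / (2 * (m + 1) * s) := Nat.floor_le (by positivity)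
      have hj2 : β * #V₀ / (2 * (m + 1) * s) < j + 1 := Nat.lt_floor_add_one _
      rw [le_div_iff₀' (by positivity)] at hj1
      rw [div_lt_iff₀' (by positivity)] at hj2
      obtain ⟨Y₁, Y₂, h1, h2, hd, hV1, hV2, -, hc⟩ := exists_improve_many hm hs hβ hmβ hdeg hX hXV
        hM hsM (K := κ * #V₀)
        (le_trans (by have : (0 : ℝ) ≤ 4 * s * 2 ^ M + 2 ^ (2 * (m * s)) * (2 * s) := by positivity
                      linarith) hK)
        (le_trans (by have : (0 : ℝ) ≤ 2 * M + 2 ^ (2 * (m * s)) * (2 * s) := by positivity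
                      linarith) hK)
        (le_trans (by have : (0 : ℝ) ≤ 2 * M + 4 * s * 2 ^ M := by positivity
                      linarith) hK) j hj1
      refine ⟨Y₁ ∪ Y₂, union_subset hV1 hV2, h1.union h2.of_mul hd, ?_⟩
      rcases hc with hc | hc
      · exact Or.inl hc.le
      · right
        have hc' : (#X + 2 * s * j : ℝ) ≤ #(Y₁ ∪ Y₂) := by exact_mod_cast hc
        have hβη : β = η * (2 * (m + 1)) := by
          rw [hη]; field_simp
        have h3 : η * (2 * (m + 1)) * #V₀ < (2 * (m + 1)) * (s * (j + 1)) := by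
          rw [← hβη]; linarith
        have h4 : η * #V₀ < s * (j + 1) := by
          have h5 : (0 : ℝ) < 2 * (m + 1) := by positivity
          refine lt_of_mul_lt_mul_left ?_ h5.le
          linarith
        push_cast
        linarith
  obtain ⟨r, hr⟩ := exists_nat_gt (1 / η)
  rw [div_lt_iff₀ hηpos] at hr
  obtain ⟨N₀, hN₀⟩ := main r s hs
  refine ⟨max N₀ 1, fun V G V₀ hV₀ hdeg => ?_⟩
  obtain ⟨X, hXV, hX, hc⟩ := hN₀ V G V₀ ((le_max_left _ _).trans hV₀) hdeg
  refine ⟨X, hXV, hX, hc.resolve_right fun hc => ?_⟩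
  have h1 : (#X : ℝ) ≤ #V₀ := by exact_mod_cast card_le_card hXV
  have h2 : (1 : ℝ) ≤ #V₀ := by exact_mod_cast (le_max_right _ _).trans hV₀
  nlinarith

end Tileable

section Embedding

variable {U V : Type*} [Fintype U] [Fintype V] {T : SimpleGraph U} {G : SimpleGraph V}

namespace AbsorbingEmbedding

variable {S : Finset U} {f : U → V} {Q : Finset U} {L : ℕ} {R : Rooting T}

/-- A small subtree `P` with root `t` can be embedded into a complete bipartite graph, where
`t` is connected to its parent by absorption. -/
theorem exists_union_piece (col : T.Coloring (Fin 2)) (h : AbsorbingEmbedding G T S f Q (L + 1))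
    (hS : R.Closed S) {P : Finset U} {t : U} (hSP : R.Closed (S ∪ P)) (hdis : Disjoint S P)
    (htP : t ∈ P) (htS : R.par t ∈ S) (hP : ∀ v ∈ P, v ≠ t → R.par v ∈ P) {A B : Finset V}
    (hA : Disjoint A (S.image f)) (hB : Disjoint B (S.image f))
    (hAB : ∀ a ∈ A, ∀ b ∈ B, G.Adj a b) (hPA : #P ≤ #A) (hPB : #P ≤ #B)
    (hPY : Fintype.card U * #P ≤ (L + 1) * #A) :
    ∃ f' Q', AbsorbingEmbedding G T (S ∪ P) f' Q' L ∧
      (S ∪ P).image f' ⊆ S.image f ∪ (A ∪ B) ∧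
      #(A ∩ (S ∪ P).image f') = #{v ∈ P | col v ≠ col t} ∧
      #(B ∩ (S ∪ P).image f') = #{v ∈ P | col v = col t} := by
  have hPpos : 0 < #P := card_pos.2 ⟨t, htP⟩
  have htS' : t ∉ S := fun h' => disjoint_left.1 hdis h' htP
  have hdAB := G.disjoint_of_forall_adj hAB
  obtain ⟨x, hxB⟩ := card_pos.1 (hPpos.trans_le hPB)
  have hxA : x ∉ A := fun h' => disjoint_left.1 hdAB h' hxB
  have hxim : x ∉ S.image f := disjoint_left.1 hB hxB
  obtain ⟨f₀, Q₀, h₀, him₀, hnb⟩ := h.absorb hS htS' htS hxim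
    (card_pos.1 (hPpos.trans_le hPA) : A.Nonempty)
  have hPnb : #P ≤ #{y ∈ A | G.Adj (f₀ t) y} :=
    Nat.le_of_mul_le_mul_left (hPY.trans hnb) (Fintype.card_pos_iff.2 ⟨t⟩)
  have hcSP : #(S ∪ P) = #S + #P := card_union_of_disjoint hdis
  have hcS₀ := card_insert_of_notMem htS'
  have himAB : ∀ a ∈ insert t S, f₀ a ∈ A ∪ B → f₀ a = x := by
    intro a ha hy
    have h1 := mem_image_of_mem f₀ ha
    rw [him₀, mem_insert] at h1
    refine h1.resolve_right fun h2 => ?_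
    rcases mem_union.1 hy with h3 | h3
    · exact disjoint_left.1 hA h3 h2
    · exact disjoint_left.1 hB h3 h2
  have greedy : ∀ (k : ℕ) (S₁ : Finset U) (f₁ : U → V), AbsorbingEmbedding G T S₁ f₁ Q₀ L →
      R.Closed S₁ → insert t S ⊆ S₁ → S₁ ⊆ S ∪ P → (∀ a ∈ insert t S, f₁ a = f₀ a) →
      (∀ v ∈ S₁, v ∉ insert t S → f₁ v ∈ if col v = col t then B else A) →
      #(S ∪ P) - #S₁ = k →
      ∃ f', AbsorbingEmbedding G T (S ∪ P) f' Q₀ L ∧ (∀ a ∈ insert t S, f' a = f₀ a) ∧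
        ∀ v ∈ S ∪ P, v ∉ insert t S → f' v ∈ if col v = col t then B else A := by
    intro k
    induction k with
    | zero =>
      intro S₁ f₁ h1 _ _ hsub hf hside hk
      rw [eq_of_subset_of_card_le hsub (by omega)] at h1 hside
      exact ⟨f₁, h1, hf, hside⟩
    | succ k ih =>
      intro S₁ f₁ h1 hcl hsub' hsub hf hside hk
      obtain ⟨v, hvSP, hv, hpv⟩ := hcl.exists_attached hSP (fun h' => by
        have := card_le_card h'; omega)
      have hvt : v ≠ t := fun h' => hv (hsub' (h' ▸ mem_insert_self _ _))
      have hvS : v ∉ S := fun h' => hv (hsub' (mem_insert_of_mem h'))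
      have hvi : v ∉ insert t S := fun h' => hv (hsub' h')
      have hvP : v ∈ P := (mem_union.1 hvSP).resolve_left hvS
      have hpP := hP v hvP hvt
      have hcol := col.valid (R.adj_par v fun h' => hvS (h' ▸ hS.1))
      set N : Finset V := if R.par v = t then {y ∈ A | G.Adj (f₀ t) y} else
        if col v = col t then B else A with hN
      have hcN : #P ≤ #N := by
        rw [hN]; split_ifs <;> assumption
      have hNside : N ⊆ if col v = col t then B else A := by
        rw [hN]
        split_ifs with h2 h3
        · exact absurd (h2 ▸ h3) hcol
        · exact filter_subset _ _
        · exact Subset.rfl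
        · exact Subset.rfl
      have hNAB : N ⊆ A ∪ B := by
        refine hNside.trans ?_
        split_ifs
        · exact subset_union_right
        · exact subset_union_left
      have hNadj : ∀ y ∈ N, G.Adj (f₁ (R.par v)) y := by
        intro y hy
        by_cases h2 : R.par v = t
        · rw [hN, if_pos h2, mem_filter] at hy
          rw [h2, hf t (mem_insert_self _ _)]
          exact hy.2
        · rw [hN, if_neg h2] at hy
          have h3 := hside (R.par v) hpv (by
            rw [mem_insert, not_or]
            exact ⟨h2, fun h' => disjoint_left.1 hdis h' hpP⟩)
          by_cases h4 : col v = col t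
          · rw [if_pos h4] at hy
            rw [if_neg (fun h5 => hcol (h4.trans h5.symm))] at h3
            exact hAB _ h3 _ hy
          · rw [if_neg h4] at hy
            rw [if_pos (by omega)] at h3
            exact (hAB _ hy _ h3).symm
      obtain ⟨y, hyN, hyim⟩ : ∃ y ∈ N, y ∉ S₁.image f₁ := by
        by_contra! hcon
        have h2 : N ⊆ insert x ((S₁ \ insert t S).image f₁) := by
          intro y hy
          obtain ⟨a, ha, rfl⟩ := mem_image.1 (hcon y hy)
          by_cases hai : a ∈ insert t S
          · rw [mem_insert, hf a hai]
            left
            exact himAB a hai (hf a hai ▸ hNAB hy)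
          · exact mem_insert_of_mem (mem_image_of_mem _ (mem_sdiff.2 ⟨ha, hai⟩))
        have h3 := (card_le_card h2).trans (card_insert_le _ _)
        have h4 := card_image_le (s := S₁ \ insert t S) (f := f₁)
        rw [card_sdiff_of_subset hsub'] at h4
        have h5 := card_le_card hsub'
        omega
      have hc := card_insert_of_notMem hv
      refine ih _ _ (h1.extend hcl hv hpv hyim (hNadj y hyN)) (hcl.insert_attached hpv)
        (hsub'.trans (subset_insert _ _)) (insert_subset hvSP hsub) ?_ ?_ (by omega)
      · intro a ha
        rw [Function.update_of_ne (ne_of_mem_of_not_mem ha hvi), hf a ha]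
      · intro w hw hwi
        by_cases hwv : w = v
        · subst hwv
          rw [Function.update_self]
          exact hNside hyN
        · rw [Function.update_of_ne hwv]
          exact hside w ((mem_insert.1 hw).resolve_left hwv) hwi
  obtain ⟨f', h', hf', hside⟩ := greedy _ _ f₀ h₀ (hS.insert_attached htS) Subset.rfl
    (insert_subset (mem_union_right _ htP) subset_union_left) (fun _ _ => rfl)
    (fun v hv hv' => absurd hv hv') rfl
  have hinj : Set.InjOn f' (S ∪ P : Finset U) := fun a ha b hb => h'.inj a ha b hb
  have hPi : ∀ v ∈ P, v ≠ t → v ∈ S ∪ P ∧ v ∉ insert t S := fun v hv hvt =>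
    ⟨mem_union_right _ hv, by
      rw [mem_insert, not_or]
      exact ⟨hvt, fun h2 => disjoint_left.1 hdis h2 hv⟩⟩
  have him : ∀ y ∈ (S ∪ P).image f', y ∈ insert x (S.image f) ∨
      ∃ v ∈ P, v ≠ t ∧ f' v = y := by
    intro y hy
    obtain ⟨a, ha, rfl⟩ := mem_image.1 hy
    by_cases hai : a ∈ insert t S
    · left
      rw [hf' a hai, ← him₀]
      exact mem_image_of_mem _ hai
    · rw [mem_insert, not_or] at hai
      exact Or.inr ⟨a, (mem_union.1 ha).resolve_left hai.2, hai.1, rfl⟩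
  have hxim' : ∃ a ∈ insert t S, f' a = x := by
    obtain ⟨a, ha, hax⟩ := mem_image.1 (him₀ ▸ mem_insert_self x _ : x ∈ (insert t S).image f₀)
    exact ⟨a, ha, (hf' a ha).trans hax⟩
  obtain ⟨a₀, ha₀, hfa₀⟩ := hxim'
  have ha₀' : a₀ ∈ S ∪ P := insert_subset (mem_union_right _ htP) subset_union_left ha₀
  refine ⟨f', Q₀, h', ?_, ?_, ?_⟩
  · intro y hy
    rcases him y hy with h2 | ⟨v, hv, hvt, rfl⟩
    · rcases mem_insert.1 h2 with rfl | h2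
      · exact mem_union_right _ (mem_union_right _ hxB)
      · exact mem_union_left _ h2
    · have h3 := hside v (hPi v hv hvt).1 (hPi v hv hvt).2
      refine mem_union_right _ ?_
      split_ifs at h3
      · exact mem_union_right _ h3
      · exact mem_union_left _ h3
  · have : A ∩ (S ∪ P).image f' = ({v ∈ P | col v ≠ col t} : Finset U).image f' := by
      ext y
      constructor
      · intro hy
        obtain ⟨hyA, hy⟩ := mem_inter.1 hy
        rcases him y hy with h2 | ⟨v, hv, hvt, rfl⟩
        · rcases mem_insert.1 h2 with rfl | h2
          · exact absurd hyA hxA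
          · exact absurd h2 (disjoint_left.1 hA hyA)
        · have h3 := hside v (hPi v hv hvt).1 (hPi v hv hvt).2
          refine mem_image_of_mem _ (mem_filter.2 ⟨hv, fun hc => ?_⟩)
          rw [if_pos hc] at h3
          exact disjoint_left.1 hdAB hyA h3
      · intro hy
        obtain ⟨v, hv, rfl⟩ := mem_image.1 hy
        rw [mem_filter] at hv
        have hvt : v ≠ t := fun h2 => hv.2 (h2 ▸ rfl)
        have h3 := hside v (hPi v hv.1 hvt).1 (hPi v hv.1 hvt).2
        rw [if_neg hv.2] at h3
        exact mem_inter.2 ⟨h3, mem_image_of_mem _ (mem_union_right _ hv.1)⟩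
    rw [this, card_image_of_injOn]
    exact hinj.mono fun v hv => mem_union_right _ (mem_filter.1 hv).1
  · have : B ∩ (S ∪ P).image f' =
        insert x ((({v ∈ P | col v = col t} : Finset U).erase t).image f') := by
      ext y
      constructor
      · intro hy
        obtain ⟨hyB, hy⟩ := mem_inter.1 hy
        rcases him y hy with h2 | ⟨v, hv, hvt, rfl⟩
        · rcases mem_insert.1 h2 with rfl | h2
          · exact mem_insert_self _ _
          · exact absurd h2 (disjoint_left.1 hB hyB)
        · have h3 := hside v (hPi v hv hvt).1 (hPi v hv hvt).2
          refine mem_insert_of_mem (mem_image_of_mem _ (mem_erase.2 ⟨hvt, mem_filter.2 ⟨hv, ?_⟩⟩))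
          by_contra hc
          rw [if_neg hc] at h3
          exact disjoint_left.1 hdAB h3 hyB
      · intro hy
        rcases mem_insert.1 hy with rfl | hy
        · exact mem_inter.2 ⟨hxB, hfa₀ ▸ mem_image_of_mem _ ha₀'⟩
        · obtain ⟨v, hv, rfl⟩ := mem_image.1 hy
          rw [mem_erase, mem_filter] at hv
          have h3 := hside v (hPi v hv.2.1 hv.1).1 (hPi v hv.2.1 hv.1).2
          rw [if_pos hv.2.2] at h3
          exact mem_inter.2 ⟨h3, mem_image_of_mem _ (mem_union_right _ hv.2.1)⟩
    rw [this, card_insert_of_notMem, card_image_of_injOn, card_erase_add_one]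
    · exact mem_filter.2 ⟨htP, rfl⟩
    · exact hinj.mono fun v hv => mem_union_right _ (mem_filter.1 (mem_of_mem_erase hv)).1
    · intro hx
      obtain ⟨v, hv, hvx⟩ := mem_image.1 hx
      rw [mem_erase, mem_filter] at hv
      have h2 := hPi v hv.2.1 hv.1
      exact h2.2 (hinj h2.1 ha₀' (hvx.trans hfa₀.symm) ▸ ha₀)

end AbsorbingEmbedding

end Embedding

namespace Rooting

variable {U : Type*} [Fintype U] {T : SimpleGraph U} {R : Rooting T}

theorem Closed.mem_of_mem_desc {C : Finset U} (hC : R.Closed C) {c w : U} (hc : c ∈ C)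
    (h : c ∈ R.desc w) : w ∈ C := by
  simp only [desc, mem_filter, mem_univ, true_and] at h
  obtain ⟨k, rfl⟩ := h
  induction k with
  | zero => exact hc
  | succ k ih =>
    rw [Function.iterate_succ_apply']
    exact hC.2 _ ih

theorem par_notMem_desc {w : U} (hw : w ≠ R.root) : R.par w ∉ R.desc w := fun h =>
  absurd (rk_le_of_mem_desc h) (not_le.2 (R.rk_par w hw))

/-- A bounded subtree that can be removed from a closed set `C'` containing `C`, if only one
vertex is attached to `C`. -/
theorem Closed.exists_piece {Δ : ℕ} (hΔ : ∀ v, #{w | T.Adj v w} ≤ Δ) {C C' : Finset U}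
    (hC : R.Closed C) (hC' : R.Closed C') (hne : ¬C' ⊆ C) {v' : U}
    (hv' : ∀ b, b ∉ C → R.par b ∈ C → b = v') {s : ℕ} (hs : 0 < s) :
    ∃ w ∈ C', w ∉ C ∧ #(C' ∩ R.desc w) ≤ Δ * s + 1 ∧
      (s ≤ #(C' ∩ R.desc w) ∨ C' \ R.desc w ⊆ C) := by
  obtain ⟨b, hbC', hbC, hpb⟩ := hC.exists_attached hC' hne
  obtain rfl := hv' b hbC hpb
  by_cases hcard : s ≤ #(C' ∩ R.desc b)
  · obtain ⟨w, hw, h1, h2⟩ := exists_desc_card hΔ C' (C' \ C) hC'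
      (fun c hc hpc => mem_sdiff.2 ⟨hc, fun h => (mem_sdiff.1 hpc).2 (hC.2 c h)⟩)
      (mem_sdiff.2 ⟨hbC', hbC⟩) hs hcard
    exact ⟨w, (mem_sdiff.1 hw).1, (mem_sdiff.1 hw).2, h2, Or.inl h1⟩
  · have hbr : b ≠ R.root := fun h => hbC (h ▸ hC.1)
    have hΔ1 : 1 ≤ Δ := by
      refine le_trans (card_pos.2 ⟨R.par b, ?_⟩) (hΔ b)
      simpa using R.adj_par b hbr
    refine ⟨b, hbC', hbC, ?_, Or.inr ?_⟩
    · nlinarith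
    · by_contra hcon
      obtain ⟨c, hc, hcC, hpc⟩ := hC.exists_attached (hC'.sdiff_desc hbr) hcon
      rw [hv' c hcC hpc] at hc
      exact (mem_sdiff.1 hc).2 (self_mem_desc b)

end Rooting

section Embedding

variable {U V : Type*} [Fintype U] [Fintype V] {T : SimpleGraph U} {G : SimpleGraph V}

namespace AbsorbingEmbedding

variable {S : Finset U} {f : U → V} {Q : Finset U} {L : ℕ} {R : Rooting T}

/-- A small subtree can be embedded into a complete bipartite graph in such a way that the unused
parts of both sides have similar sizes. -/
theorem exists_union_piece_balanced (col : T.Coloring (Fin 2))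
    (h : AbsorbingEmbedding G T S f Q (L + 1))
    (hS : R.Closed S) {P : Finset U} {t : U} (hSP : R.Closed (S ∪ P)) (hdis : Disjoint S P)
    (htP : t ∈ P) (htS : R.par t ∈ S) (hP : ∀ v ∈ P, v ≠ t → R.par v ∈ P) {A B : Finset V}
    (hA : Disjoint A (S.image f)) (hB : Disjoint B (S.image f))
    (hAB : ∀ a ∈ A, ∀ b ∈ B, G.Adj a b) {s μ : ℕ} (hPs : #P ≤ s) (hsμ : s ≤ μ)
    (hμA : μ ≤ #A) (hμB : μ ≤ #B) (hμ : Fintype.card U * s ≤ (L + 1) * μ)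
    (hbal : #A ≤ #B + s ∧ #B ≤ #A + s) :
    ∃ f' Q' A' B', AbsorbingEmbedding G T (S ∪ P) f' Q' L ∧
      (S ∪ P).image f' ⊆ S.image f ∪ (A ∪ B) ∧ A' ⊆ A ∧ B' ⊆ B ∧
      Disjoint A' ((S ∪ P).image f') ∧ Disjoint B' ((S ∪ P).image f') ∧
      #A + #B = #A' + #B' + #P ∧ #A' ≤ #B' + s ∧ #B' ≤ #A' + s := by
  have hYA : Fintype.card U * #P ≤ (L + 1) * #A := (Nat.mul_le_mul_left _ hPs).trans
    (hμ.trans (Nat.mul_le_mul_left _ hμA))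
  have hYB : Fintype.card U * #P ≤ (L + 1) * #B := (Nat.mul_le_mul_left _ hPs).trans
    (hμ.trans (Nat.mul_le_mul_left _ hμB))
  have hcP : #{v ∈ P | col v = col t} + #{v ∈ P | col v ≠ col t} = #P :=
    card_filter_add_card_filter_not (s := P) (fun v => col v = col t)
  by_cases hor : (#B ≤ #A ∧ #{v ∈ P | col v = col t} ≤ #{v ∈ P | col v ≠ col t}) ∨
      (#A ≤ #B ∧ #{v ∈ P | col v ≠ col t} ≤ #{v ∈ P | col v = col t})
  · obtain ⟨f', Q', h', him, hcA, hcB⟩ := h.exists_union_piece col hS hSP hdis htP htS hP hA hB hAB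
      (by omega) (by omega) hYA
    have h1 := card_sdiff_add_card_inter A ((S ∪ P).image f')
    have h2 := card_sdiff_add_card_inter B ((S ∪ P).image f')
    exact ⟨f', Q', A \ (S ∪ P).image f', B \ (S ∪ P).image f', h', him, sdiff_subset, sdiff_subset,
      sdiff_disjoint, sdiff_disjoint, by omega, by omega, by omega⟩
  · obtain ⟨f', Q', h', him, hcB, hcA⟩ := h.exists_union_piece col hS hSP hdis htP htS hP hB hA
      (fun b hb a ha => (hAB a ha b hb).symm) (by omega) (by omega) hYB
    have h1 := card_sdiff_add_card_inter A ((S ∪ P).image f')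
    have h2 := card_sdiff_add_card_inter B ((S ∪ P).image f')
    rw [union_comm B A] at him
    exact ⟨f', Q', A \ (S ∪ P).image f', B \ (S ∪ P).image f', h', him, sdiff_subset, sdiff_subset,
      sdiff_disjoint, sdiff_disjoint, by omega, by omega, by omega⟩

/-- Piece by piece, an embedding of `C` is extended into a set tiled by complete bipartite
graphs; `A` and `B` are the unused parts of the current tile, and `X` consists of the unused
tiles. -/
theorem exists_extend_tileable (col : T.Coloring (Fin 2)) {Δ : ℕ}
    (hΔ : ∀ v, #{w | T.Adj v w} ≤ Δ) {C : Finset U} (hC : R.Closed C) {v' : U}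
    (hv' : ∀ b, b ∉ C → R.par b ∈ C → b = v') {L₀ L₁ s μ t : ℕ} {f₀ : U → V} {Q₀ : Finset U}
    (h₀ : AbsorbingEmbedding G T C f₀ Q₀ L₀) (hs : 0 < s) (hsμ : Δ * s + 1 ≤ μ) (hμt : μ ≤ t)
    (hL : Fintype.card U + (L₁ + 1) * s + s ≤ L₀ * s)
    (hμ : Fintype.card U * (Δ * s + 1) ≤ (L₁ + 1) * μ) {ω : ℝ}
    (hω : (2 * μ + (Δ * s + 1 : ℕ) : ℝ) ≤ ω * (2 * t)) {X₀ : Finset V}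
    (hX₀ : Tileable G t X₀) (hX₀f : Disjoint X₀ (C.image f₀)) {C' : Finset U}
    (hC' : R.Closed C') (hCC' : C ⊆ C') (hcard : #(C' \ C) + ω * (2 * t) < (1 - ω) * #X₀) :
    ∃ (f : U → V) (Q : Finset U) (L : ℕ) (A B X : Finset V), AbsorbingEmbedding G T C' f Q L ∧
      L₀ * s ≤ L * s + #(C' \ C) + s ∧ (C' ⊆ C → L = L₀) ∧
      Disjoint A (C'.image f) ∧ Disjoint B (C'.image f) ∧ Disjoint X (C'.image f) ∧
      Disjoint (A ∪ B) X ∧ (∀ a ∈ A, ∀ b ∈ B, G.Adj a b) ∧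
      #A ≤ #B + (Δ * s + 1) ∧ #B ≤ #A + (Δ * s + 1) ∧ Tileable G t X ∧
      (1 - ω) * #X₀ ≤ #A + #B + (1 - ω) * #X + #(C' \ C) := by
  induction hn : #C' using Nat.strong_induction_on generalizing C' with
  | _ n ih =>
  by_cases hsub : C' ⊆ C
  · obtain rfl := subset_antisymm hsub hCC'
    exact ⟨f₀, Q₀, L₀, ∅, ∅, X₀, h₀, by omega, fun _ => rfl, disjoint_empty_left _,
      disjoint_empty_left _, hX₀f, by simp, by simp, by simp, by simp, hX₀, by simp⟩
  obtain ⟨w, hwC', hwC, hcP, hPs⟩ := hC.exists_piece hΔ hC' hsub hv' hs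
  have hwr : w ≠ R.root := fun h => hwC (h ▸ hC.1)
  set P := C' ∩ R.desc w with hP
  set S := C' \ R.desc w with hSdef
  have hS : R.Closed S := hC'.sdiff_desc hwr
  have hwP : w ∈ P := mem_inter.2 ⟨hwC', Rooting.self_mem_desc w⟩
  have hCS : C ⊆ S := fun c hc => mem_sdiff.2 ⟨hCC' hc, fun h => hwC (hC.mem_of_mem_desc hc h)⟩
  have hSP : S ∪ P = C' := sdiff_union_inter _ _
  have hdis : Disjoint S P := disjoint_sdiff_inter _ _
  have hcSP : #S + #P = #C' := by rw [← card_union_of_disjoint hdis, hSP]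
  have hPpos : 0 < #P := card_pos.2 ⟨w, hwP⟩
  have hc1 := card_sdiff_add_card_eq_card hCC'
  have hc2 := card_sdiff_add_card_eq_card hCS
  have hcSC : #(C' \ C) = #(S \ C) + #P := by omega
  have hcSCr : (#(C' \ C) : ℝ) = #(S \ C) + #P := by exact_mod_cast hcSC
  obtain ⟨f, Q, L, A, B, X, h, hLs, hLC, hA, hB, hX, hABX, hAB, hbal1, hbal2, hXt, hcap⟩ :=
    ih #S (by omega) hS hCS (by
      have : (0 : ℝ) ≤ #P := Nat.cast_nonneg _
      linarith) rfl
  have hSn : #(S \ C) ≤ Fintype.card U := card_le_univ _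
  have hLL₁ : L₁ + 1 ≤ L := Nat.le_of_mul_le_mul_right (by omega : (L₁ + 1) * s ≤ L * s) hs
  obtain ⟨L, rfl⟩ : ∃ k, L = k + 1 := ⟨L - 1, by omega⟩
  obtain ⟨A, B, X, hA, hB, hX, hABX, hAB, hbal1, hbal2, hXt, hcap, hμA, hμB⟩ :
      ∃ A B X : Finset V, Disjoint A (S.image f) ∧ Disjoint B (S.image f) ∧
        Disjoint X (S.image f) ∧ Disjoint (A ∪ B) X ∧ (∀ a ∈ A, ∀ b ∈ B, G.Adj a b) ∧
        #A ≤ #B + (Δ * s + 1) ∧ #B ≤ #A + (Δ * s + 1) ∧ Tileable G t X ∧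
        (1 - ω) * #X₀ ≤ #A + #B + (1 - ω) * #X + #(S \ C) ∧ μ ≤ #A ∧ μ ≤ #B := by
    by_cases hμAB : μ ≤ #A ∧ μ ≤ #B
    · exact ⟨A, B, X, hA, hB, hX, hABX, hAB, hbal1, hbal2, hXt, hcap, hμAB⟩
    have hsmall : #A + #B ≤ 2 * μ + (Δ * s + 1) := by omega
    have hsmall' : (#A + #B : ℝ) ≤ ω * (2 * t) := by
      refine le_trans ?_ hω
      exact_mod_cast hsmall
    have hPr : (0 : ℝ) ≤ #P := Nat.cast_nonneg _
    cases hXt with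
    | empty =>
      rw [card_empty, Nat.cast_zero, mul_zero] at hcap
      linarith
    | @add A₁ B₁ X₁ hA₁ hB₁ hAB₁ hd hX₁ =>
      rw [disjoint_union_left, disjoint_union_left] at hX
      refine ⟨A₁, B₁, X₁, hX.1.1, hX.1.2, hX.2, hd, hAB₁, by omega, by omega, hX₁, ?_, by omega,
        by omega⟩
      rw [card_union_of_disjoint hd, card_union_of_disjoint (G.disjoint_of_forall_adj hAB₁), hA₁,
        hB₁] at hcap
      rw [hA₁, hB₁]
      push_cast at hcap
      linarith
  have hpS : R.par w ∈ S := mem_sdiff.2 ⟨hC'.2 _ hwC', Rooting.par_notMem_desc hwr⟩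
  obtain ⟨f', Q', A', B', h', him, hA', hB', hdA', hdB', hcAB, hb1, hb2⟩ :=
    h.exists_union_piece_balanced col hS (hSP.symm ▸ hC') hdis hwP hpS
      (fun v hv hvw => mem_inter.2 ⟨hC'.2 _ (mem_inter.1 hv).1,
        Rooting.par_mem_desc (mem_inter.1 hv).2 hvw⟩) hA hB hAB hcP hsμ hμA hμB
      (hμ.trans (Nat.mul_le_mul_right _ (by omega))) ⟨hbal1, hbal2⟩
  rw [hSP] at h' him hdA' hdB'
  refine ⟨f', Q', L, A', B', X, h', ?_, fun h => absurd h hsub, hdA', hdB', ?_, ?_,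
    fun a ha b hb => hAB a (hA' ha) b (hB' hb), hb1, hb2, hXt, ?_⟩
  · rw [add_one_mul] at hLs
    rcases hPs with hPs | hPs
    · omega
    · rw [← hLC hPs, add_one_mul]
      omega
  · exact (disjoint_union_right.2 ⟨hX, hABX.symm⟩).mono_right him
  · exact hABX.mono_left (union_subset_union hA' hB')
  · have : (#A + #B : ℝ) = #A' + #B' + #P := by exact_mod_cast hcAB
    linarith

end AbsorbingEmbedding

end Embedding

/-- Linear functions eventually dominate constants and the logarithm. -/
theorem exists_forall_log_le {c : ℝ} (hc : 0 < c) (K : ℝ) :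
    ∃ n₀ : ℕ, ∀ n : ℕ, n₀ ≤ n → K ≤ c * n ∧ Real.log n ≤ c * n := by
  have h1 : ∀ᶠ x : ℝ in Filter.atTop, Real.log x ≤ c * x := by
    filter_upwards [Real.isLittleO_log_id_atTop.bound hc, Filter.eventually_ge_atTop 1]
      with x hx hx1
    rwa [id, Real.norm_of_nonneg (Real.log_nonneg hx1), Real.norm_of_nonneg (by linarith)] at hx
  have h2 : ∀ᶠ x : ℝ in Filter.atTop, K ≤ c * x :=
    (Filter.tendsto_id.const_mul_atTop hc).eventually_ge_atTop K
  exact Filter.eventually_atTop.1 (tendsto_natCast_atTop_atTop.eventually (h2.and h1))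

/-- A small pendant subtree of a bounded degree tree can be embedded so that linearly many
absorptions are possible. -/
theorem AbsorbingEmbedding.exists_pendant_absorbing (Δ : ℕ) {γ : ℝ} (hγ : 0 < γ) (hγ1 : γ ≤ 1) :
    ∃ c : ℝ, 0 < c ∧ c ≤ 1 ∧ ∃ n₀ : ℕ, ∀ (U V : Type*) [Fintype U] [Fintype V]
      (T : SimpleGraph U) (G : SimpleGraph V), n₀ ≤ Fintype.card V →
      Fintype.card U = Fintype.card V → T.IsTree → (∀ v, #{w | T.Adj v w} ≤ Δ) →
      (∀ u v, 2 * γ * Fintype.card V ≤ #{w | G.Adj u w ∧ G.Adj v w}) →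
      ∃ (R : Rooting T) (C : Finset U) (v' : U) (f : U → V) (Q : Finset U) (L : ℕ),
        R.Closed C ∧ (∀ b, b ∉ C → R.par b ∈ C → b = v') ∧ AbsorbingEmbedding G T C f Q L ∧
        (#C : ℝ) ≤ γ / 2 * Fintype.card V ∧ c * Fintype.card V ≤ L := by
  set D : ℝ := Δ + 1 with hD
  have hD1 : 1 ≤ D := by simp [hD]
  set τ : ℝ := γ / (4 * D) with hτ
  have hτ0 : 0 < τ := by positivity
  have hτD : 4 * D * τ = γ := by rw [hτ]; field_simp
  set σ : ℝ := τ / (2 * D ^ 2 * (Δ + 3)) with hσ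
  have hσ0 : 0 < σ := by positivity
  have hσD : 2 * D ^ 2 * (Δ + 3) * σ = τ := by rw [hσ]; field_simp
  set p : ℝ := γ ^ (Δ + 2) / 2 with hp
  have hp0 : 0 < p := by positivity
  have hp1 : p ≤ 1 := by
    have := pow_le_one₀ (n := Δ + 2) hγ.le hγ1
    linarith
  have hτγ : τ ≤ γ / 4 := by nlinarith
  have hστ : σ ≤ τ := by
    have h1 : 1 ≤ 2 * D ^ 2 * (Δ + 3 : ℝ) := by
      have h2 : (1 : ℝ) ≤ Δ + 3 := by linarith [Nat.cast_nonneg (α := ℝ) Δ]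
      nlinarith
    nlinarith
  set c : ℝ := p * σ / 8 with hc
  have hc0 : 0 < c := by positivity
  have hcσ : c ≤ σ := by rw [hc]; nlinarith
  obtain ⟨n₀, hn₀⟩ := exists_forall_log_le hc0 (4 * D ^ 2)
  refine ⟨c, hc0, by linarith, n₀, ?_⟩
  intro U V _ _ T G hn hUV hT hΔ hG
  obtain ⟨hK, hlog⟩ := hn₀ _ hn
  set n : ℕ := Fintype.card V
  have hn0 : (0 : ℝ) ≤ n := Nat.cast_nonneg n
  have hcn : c * n ≤ σ * n := mul_le_mul_of_nonneg_right hcσ hn0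
  have hσn : σ * n ≤ τ * n := mul_le_mul_of_nonneg_right hστ hn0
  have hτn : τ * n ≤ γ / 4 * n := mul_le_mul_of_nonneg_right hτγ hn0
  have hγn : γ * n ≤ n := by nlinarith
  have hD2 : D ≤ D ^ 2 := by nlinarith
  have hs1 : τ * n ≤ ⌈τ * n⌉₊ := Nat.le_ceil _
  have hs2 : (⌈τ * n⌉₊ : ℝ) < τ * n + 1 := Nat.ceil_lt_add_one (by positivity)
  obtain ⟨R, C, hC, hsC, hCs, hCn, v', hv'⟩ := hT.exists_pendant hΔ
    (s := ⌈τ * n⌉₊) (Nat.ceil_pos.2 (by linarith)) (by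
      rw [hUV]
      exact Nat.ceil_le.2 (by linarith))
  have hsC' : (⌈τ * n⌉₊ : ℝ) ≤ #C := by exact_mod_cast hsC
  have hCs' : (#C : ℝ) ≤ γ / 2 * n := by
    have h1 : (#C : ℝ) ≤ Δ * ⌈τ * n⌉₊ + 1 := by exact_mod_cast hCs
    have h2 : (Δ : ℝ) * ⌈τ * n⌉₊ ≤ Δ * (τ * n + 1) := by gcongr
    have h3 : (Δ : ℝ) * (τ * n + 1) + 1 = γ / 4 * n - τ * n + D := by
      rw [← hτD, hD]; ring
    linarith
  have hj1 : (⌊σ * n⌋₊ : ℝ) ≤ σ * n := Nat.floor_le (by positivity)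
  have hj2 : σ * n < ⌊σ * n⌋₊ + 1 := Nat.lt_floor_add_one _
  have hjs : D ^ 2 * (⌊σ * n⌋₊ * (Δ + 3) + 1) ≤ τ * n / 2 + D ^ 2 := by
    have h1 : D ^ 2 * (⌊σ * n⌋₊ * (Δ + 3)) ≤ D ^ 2 * (σ * n * (Δ + 3)) := by gcongr
    have h2 : D ^ 2 * (σ * n * (Δ + 3)) = τ * n / 2 := by rw [← hσD]; ring
    linarith
  have hlow : (⌊σ * n⌋₊ * (Δ + 3) + 1 : ℝ) ≤ D ^ 2 * (⌊σ * n⌋₊ * (Δ + 3) + 1) :=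
    le_mul_of_one_le_left (by positivity) (by linarith)
  have hL2 : (⌈c * n⌉₊ : ℝ) < c * n + 1 := Nat.ceil_lt_add_one (by positivity)
  obtain ⟨f, Q, hf⟩ := AbsorbingEmbedding.exists_absorbing (L := ⌈c * n⌉₊) (j := ⌊σ * n⌋₊)
    hγ hγ1 hG hΔ hC hCn
    (by
      have h1 : ((Δ + 1) ^ 2 * (⌊σ * n⌋₊ * (Δ + 3) + 1) : ℝ) < #C := by
        rw [← hD]; linarith
      exact_mod_cast h1)
    (by linarith) (by linarith) (by
      change (⌈c * n⌉₊ : ℝ) + 3 * Real.log n ≤ p * ⌊σ * n⌋₊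
      have h1 : p * (σ * n) ≤ p * (⌊σ * n⌋₊ + 1) := by gcongr
      have h2 : p * (σ * n) = 8 * (c * n) := by rw [hc]; ring
      linarith)
  exact ⟨R, C, v', f, Q, _, hC, hv', hf, hCs', Nat.le_ceil _⟩

/-- Graphs of minimum degree above half the order contain all spanning trees of bounded degree. -/
theorem SimpleGraph.exists_spanning_tree_embedding (Δ : ℕ) {γ : ℝ} (hγ : 0 < γ) (hγ1 : γ ≤ 1) :
    ∃ n₀ : ℕ, ∀ (U V : Type*) [Fintype U] [Fintype V] (T : SimpleGraph U) (G : SimpleGraph V),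
      n₀ ≤ Fintype.card V → Fintype.card U = Fintype.card V → T.IsTree →
      (∀ v, #{w | T.Adj v w} ≤ Δ) →
      (∀ v, (1 / 2 + γ) * Fintype.card V ≤ #{w | G.Adj v w}) →
      ∃ f : U → V, Function.Injective f ∧ ∀ a b, T.Adj a b → G.Adj (f a) (f b) := by
  obtain ⟨c, hc, hc1, n₁, hn₁⟩ := AbsorbingEmbedding.exists_pendant_absorbing Δ hγ hγ1
  obtain ⟨s, hs⟩ := exists_nat_ge (4 / c)
  have hs0 : 0 < s := by
    have h1 : 0 < 4 / c := by positivity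
    exact_mod_cast h1.trans_le hs
  rw [div_le_iff₀ hc] at hs
  obtain ⟨μ, hμ⟩ := exists_nat_ge (2 * (Δ * s + 1) / c)
  rw [div_le_iff₀ hc] at hμ
  have hsμ : Δ * s + 1 ≤ μ := by
    have h1 : (Δ * s + 1 : ℝ) ≤ μ := by
      have h2 : (μ : ℝ) * c ≤ μ := mul_le_of_le_one_right (Nat.cast_nonneg μ) hc1
      have h3 : (0 : ℝ) ≤ Δ * s + 1 := by positivity
      linarith
    exact_mod_cast h1
  have hω : 0 < c / 8 := by positivity
  obtain ⟨t', ht'⟩ := exists_nat_ge ((2 * μ + (Δ * s + 1 : ℕ) : ℝ) / (c / 8 * 2))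
  rw [div_le_iff₀ (by positivity)] at ht'
  set t := max t' μ with ht_def
  have ht : (2 * μ + (Δ * s + 1 : ℕ) : ℝ) ≤ c / 8 * (2 * t) := by
    have h1 : (t' : ℝ) ≤ t := by exact_mod_cast le_max_left t' μ
    nlinarith
  have hμt : μ ≤ t := le_max_right _ _
  obtain ⟨N₀, hN₀⟩ := Tileable.exists_almost_tiling (β := γ / 8) (κ := c / 8) (by positivity) hω
    (s := t) (by omega)
  obtain ⟨n₂, hn₂⟩ := exists_forall_log_le hc (8 + 8 * (c / 8 * (2 * t)))
  refine ⟨max n₁ (max n₂ (2 * N₀)), ?_⟩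
  intro U V _ _ T G hn hUV hT hΔ hG
  simp only [max_le_iff] at hn
  obtain ⟨hnn₁, hnn₂, hnN⟩ := hn
  have hK := (hn₂ _ hnn₂).1
  obtain ⟨R, C, v', f₀, Q₀, L₀, hC, hv', h₀, hCγ, hL₀⟩ := hn₁ U V T G hnn₁ hUV hT hΔ (by
    intro u v
    have h1 := card_union_add_card_inter ({w | G.Adj u w} : Finset V) {w | G.Adj v w}
    have h2 := card_le_univ (({w | G.Adj u w} : Finset V) ∪ ({w | G.Adj v w} : Finset V))
    rw [← filter_and] at h1
    have h3 : (#{w | G.Adj u w} + #{w | G.Adj v w} : ℝ) ≤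
        Fintype.card V + #{w | G.Adj u w ∧ G.Adj v w} := by
      norm_cast
      omega
    linarith [hG u, hG v])
  set n : ℕ := Fintype.card V with hn_def
  have hn0 : (0 : ℝ) ≤ n := Nat.cast_nonneg n
  have hγn : γ * n ≤ n := by nlinarith
  have hcn : c * n ≤ n := by nlinarith
  have htpos : 0 ≤ c / 8 * (2 * t) := by positivity
  have hL₁ : (⌊c * n / 2⌋₊ : ℝ) ≤ c * n / 2 := Nat.floor_le (by positivity)
  have hL₁' : c * n / 2 < ⌊c * n / 2⌋₊ + 1 := Nat.lt_floor_add_one _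
  set L₁ := ⌊c * n / 2⌋₊
  have hL : Fintype.card U + (L₁ + 1) * s + s ≤ L₀ * s := by
    have h1 : c * n / 4 * s ≤ (L₀ - L₁ - 2 : ℝ) * s := by
      gcongr
      linarith
    have h2 : (n + (L₁ + 1) * s + s : ℝ) ≤ L₀ * s := by nlinarith
    rw [hUV]
    exact_mod_cast h2
  have hμ' : Fintype.card U * (Δ * s + 1) ≤ (L₁ + 1) * μ := by
    have h1 : (n * (Δ * s + 1) : ℝ) ≤ (L₁ + 1) * μ := by
      have h2 : c * n / 2 * μ ≤ (L₁ + 1) * μ := by gcongr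
      nlinarith
    rw [hUV]
    exact_mod_cast h1
  set V₀ : Finset V := univ \ C.image f₀ with hV₀
  have hV₀C : #V₀ + #C = n := by
    have h1 := card_sdiff_add_card_eq_card (subset_univ (C.image f₀))
    rwa [h₀.card_image, card_univ] at h1
  have hV₀C' : (#V₀ + #C : ℝ) = n := by exact_mod_cast hV₀C
  obtain ⟨X₀, hX₀V, hX₀, hX₀c⟩ := hN₀ V G V₀
    (by
      have h1 : (2 * N₀ : ℝ) ≤ n := by exact_mod_cast hnN
      have h2 : (N₀ : ℝ) ≤ #V₀ := by linarith
      exact_mod_cast h2)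
    (by
      intro v _
      have h1 : #{w | G.Adj v w} ≤ #{w ∈ V₀ | G.Adj v w} + #C := by
        rw [← h₀.card_image]
        refine (card_le_card ?_).trans (card_union_le _ _)
        intro w hw
        by_cases hwC : w ∈ C.image f₀
        · exact mem_union_right _ hwC
        · exact mem_union_left _ (mem_filter.2 ⟨mem_sdiff.2 ⟨mem_univ _, hwC⟩,
            (mem_filter.1 hw).2⟩)
      have h2 : (#{w | G.Adj v w} : ℝ) ≤ #{w ∈ V₀ | G.Adj v w} + #C := by exact_mod_cast h1
      have h3 : (1 / 2 + 4 * (γ / 8)) * #V₀ ≤ (1 / 2 + 4 * (γ / 8)) * n := by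
        gcongr
        linarith [Nat.cast_nonneg (α := ℝ) #C]
      linarith [hG v])
  have hX₀c' : (1 - c / 8) * #V₀ ≤ #X₀ := by
    have h1 : (#(V₀ \ X₀) + #X₀ : ℝ) = #V₀ := by
      exact_mod_cast card_sdiff_add_card_eq_card hX₀V
    linarith
  have hL₁n : L₁ ≤ n := by
    have h1 : (L₁ : ℝ) ≤ n := by linarith
    exact_mod_cast h1
  obtain ⟨C', hC', hCC', -, hC'c⟩ := hC.exists_between Rooting.closed_univ (subset_univ C)
    (k := n - L₁)
    (by
      have h1 : (#C + L₁ : ℝ) ≤ n := by linarith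
      have h2 : #C + L₁ ≤ n := by exact_mod_cast h1
      omega)
    (by rw [card_univ]; omega)
  have hCC'c : #(C' \ C) + L₁ = #V₀ := by
    have h1 := card_sdiff_add_card_eq_card hCC'
    omega
  obtain ⟨f, Q, L, -, -, -, hf, hLs, -⟩ := h₀.exists_extend_tileable hT.coloringTwo hΔ hC hv' hs0
    hsμ hμt hL hμ' ht hX₀
    (Finset.disjoint_left.2 fun v hv => (mem_sdiff.1 (hX₀V hv)).2) hC' hCC' (by
      have h1 : (#(C' \ C) + L₁ : ℝ) = #V₀ := by exact_mod_cast hCC'c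
      have h2 : (1 - c / 8) * ((1 - c / 8) * #V₀) ≤ (1 - c / 8) * #X₀ := by
        gcongr
        linarith
      have h3 : c * (#V₀ : ℝ) ≤ c * n := by
        gcongr
        linarith [Nat.cast_nonneg (α := ℝ) #C]
      nlinarith [mul_nonneg (sq_nonneg c) (Nat.cast_nonneg (α := ℝ) #V₀)])
  refine hf.complete hUV hC' ?_
  have h1 : #(C' \ C) ≤ Fintype.card U := card_le_univ _
  have h2 : (L₁ + 1) * s ≤ L * s := by omega
  have h3 := Nat.le_of_mul_le_mul_right h2 hs0
  omega

end BoundedDegreeTrees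

/-- Komlós–Sárközy–Szemerédi theorem.
For every `Δ ∈ ℕ` and `α > 0` there is `n₀` such that for all `n ≥ n₀`: every
`n`-vertex graph `G` with `δ(G) ≥ (1+α)·n/2` contains a copy (the image of an
injective graph homomorphism) of every `n`-vertex tree with maximum degree at
most `Δ`. -/
theorem stmt_12 (Δ : ℕ) (α : ℝ) (hα : 0 < α) :
    ∃ n₀ : ℕ, ∀ n : ℕ, n₀ ≤ n →
      ∀ (G T : SimpleGraph (Fin n)) [DecidableRel G.Adj] [DecidableRel T.Adj],
        (1 + α) * n / 2 ≤ (G.minDegree : ℝ) →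
        T.IsTree → T.maxDegree ≤ Δ →
        ∃ f : Fin n → Fin n,
          Function.Injective f ∧ ∀ a b, T.Adj a b → G.Adj (f a) (f b) := by
  obtain ⟨n₀, h⟩ := SimpleGraph.exists_spanning_tree_embedding Δ (γ := min (α / 2) 1)
    (by positivity) (min_le_right _ _)
  refine ⟨n₀, fun n hn G T _ _ hG hT hΔ => h _ _ T G (by simpa using hn) rfl hT ?_ ?_⟩
  · intro v
    refine le_trans (le_of_eq ?_) ((T.degree_le_maxDegree v).trans hΔ)
    rw [← T.card_neighborFinset_eq_degree, T.neighborFinset_eq_filter]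
    congr!
  · intro v
    have h1 : min (α / 2) 1 * n ≤ α / 2 * n := by
      gcongr
      exact min_le_left _ _
    rw [Fintype.card_fin]
    refine le_trans ?_ (Nat.cast_le.2 ((G.minDegree_le_degree v).trans (le_of_eq ?_)))
    · linarith
    · rw [← G.card_neighborFinset_eq_degree, G.neighborFinset_eq_filter]
      congr!
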